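/- arXiv:2206.11780 — 9 statements merged into one kernel-verified Lean document; each statement's English description precedes it below -/
import Mathlib

section
/- Let X be a real normed vector space, a, b, c ∈ X, and r ≥ 0. Define x = b + ρ(a − b; r) and y = c + ρ(a − c; r). Then ‖x − y‖ ≤ ‖b − c‖. -/
/-- The radial retraction onto the closed ball of radius `r`:
`ρ(v; r) = v` if `‖v‖ ≤ r`, and `ρ(v; r) = r·v/‖v‖` otherwise. -/
noncomputable def radial {X : Type*} [NormedAddCommGroup X] [NormedSpace ℝ X]
    (v : X) (r : ℝ) : X :=
  if ‖v‖ ≤ r then v else (r / ‖v‖) • v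

/-- Subtracting the radial retraction is nonexpansive, for a pair of vectors ordered by norm. -/
theorem norm_sub_radial_sub_le_of_norm_le {X : Type*} [NormedAddCommGroup X] [NormedSpace ℝ X]
    {u v : X} {r : ℝ} (hr : 0 ≤ r) (huv : ‖v‖ ≤ ‖u‖) :
    ‖(u - radial u r) - (v - radial v r)‖ ≤ ‖u - v‖ := by
  have hsub : ‖u‖ - ‖v‖ ≤ ‖u - v‖ := norm_sub_norm_le u v
  unfold radial
  split_ifs with hu hv hv
  · simp
  · exact absurd (huv.trans hu) hv
  · have hu0 : 0 < ‖u‖ := hr.trans_lt (not_le.mp hu)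
    have hc : 0 ≤ 1 - r / ‖u‖ := by
      rw [sub_nonneg, div_le_one hu0]
      exact (not_le.mp hu).le
    calc ‖(u - (r / ‖u‖) • u) - (v - v)‖ = ‖(1 - r / ‖u‖) • u‖ := by
          congr 1; module
      _ = ‖u‖ - r := by
          rw [norm_smul, Real.norm_of_nonneg hc]
          field_simp
      _ ≤ ‖u - v‖ := by linarith
  · have hv0 : 0 < ‖v‖ := hr.trans_lt (not_le.mp hv)
    have hu0 : 0 < ‖u‖ := hv0.trans_le huv
    have hc : 0 ≤ 1 - r / ‖v‖ := by
      rw [sub_nonneg, div_le_one hv0]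
      exact (not_le.mp hv).le
    have hd : 0 ≤ r / ‖v‖ - r / ‖u‖ :=
      sub_nonneg.mpr (div_le_div_of_nonneg_left hr hv0 huv)
    calc ‖(u - (r / ‖u‖) • u) - (v - (r / ‖v‖) • v)‖
        = ‖(1 - r / ‖v‖) • (u - v) + (r / ‖v‖ - r / ‖u‖) • u‖ := by
          congr 1; module
      _ ≤ (1 - r / ‖v‖) * ‖u - v‖ + (r / ‖v‖ - r / ‖u‖) * ‖u‖ := by
          refine (norm_add_le _ _).trans_eq ?_
          rw [norm_smul, norm_smul, Real.norm_of_nonneg hc, Real.norm_of_nonneg hd]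
      _ = (1 - r / ‖v‖) * ‖u - v‖ + r / ‖v‖ * (‖u‖ - ‖v‖) := by
          field_simp
      _ ≤ (1 - r / ‖v‖) * ‖u - v‖ + r / ‖v‖ * ‖u - v‖ := by gcongr
      _ = ‖u - v‖ := by ring

/-- Subtracting the radial retraction is nonexpansive. -/
theorem norm_sub_radial_sub_le {X : Type*} [NormedAddCommGroup X] [NormedSpace ℝ X]
    (u v : X) {r : ℝ} (hr : 0 ≤ r) :
    ‖(u - radial u r) - (v - radial v r)‖ ≤ ‖u - v‖ := by
  rcases le_total ‖v‖ ‖u‖ with h | h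
  · exact norm_sub_radial_sub_le_of_norm_le hr h
  · rw [norm_sub_rev, norm_sub_rev u v]
    exact norm_sub_radial_sub_le_of_norm_le hr h

/-- For `a, b, c ∈ X` and `r ≥ 0`, with `x = b + ρ(a − b; r)` and
`y = c + ρ(a − c; r)`, one has `‖x − y‖ ≤ ‖b − c‖`. -/
theorem radial_retraction_end_balls
    {X : Type*} [NormedAddCommGroup X] [NormedSpace ℝ X]
    (a b c : X) (r : ℝ) (hr : 0 ≤ r)
    (x y : X) (hx : x = b + radial (a - b) r) (hy : y = c + radial (a - c) r) :
    ‖x - y‖ ≤ ‖b - c‖ := by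
  subst hx hy
  convert norm_sub_radial_sub_le (a - c) (a - b) hr using 2 <;> abel
end

section
/- Let X be a real normed vector space and μ a rectangular bound for X. Let t > 1 and r > 0 be real numbers, and let x, y ∈ X satisfy ‖x‖ = ‖y‖ = r. Then ‖y − x‖ + (t − 1)·‖y‖ ≤ μ·‖t·y − x‖. -/
/-- `u` is Birkhoff-James orthogonal to `v`: `‖u‖ ≤ ‖u + λ·v‖` for every real `λ`. -/
def BJOrth {X : Type*} [NormedAddCommGroup X] [NormedSpace ℝ X] (u v : X) : Prop :=
  ∀ l : ℝ, ‖u‖ ≤ ‖u + l • v‖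

/-- `μ` is a rectangular bound for `X`: `‖u‖ + ‖v‖ ≤ μ·‖u + v‖` whenever `u` is
Birkhoff-James orthogonal to `v`. -/
def RectBound (X : Type*) [NormedAddCommGroup X] [NormedSpace ℝ X] (μ : ℝ) : Prop :=
  ∀ u v : X, BJOrth u v → ‖u‖ + ‖v‖ ≤ μ * ‖u + v‖

/-- On the line through two points `x`, `y` of equal norm, a point of the segment `[x, y]` has
minimal norm, hence is Birkhoff-James orthogonal to the direction of the line. -/
lemma exists_bjOrth_sub_of_norm_eq {X : Type*} [NormedAddCommGroup X] [NormedSpace ℝ X]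
    {x y : X} (h : ‖x‖ = ‖y‖) :
    ∃ s : ℝ, 0 ≤ s ∧ BJOrth (y - s • (y - x)) (y - x) := by
  obtain ⟨s, hs, hmin⟩ := (isCompact_Icc (a := (0 : ℝ)) (b := 1)).exists_isMinOn
    ⟨0, by simp⟩ (f := fun s : ℝ => ‖y - s • (y - x)‖) (by fun_prop)
  have hmin' : ∀ p ∈ Set.Icc (0 : ℝ) 1, ‖y - s • (y - x)‖ ≤ ‖y - p • (y - x)‖ :=
    fun p hp => hmin hp
  have h_zero : ‖y - s • (y - x)‖ ≤ ‖y‖ := by simpa using hmin' 0 (by simp)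
  refine ⟨s, hs.1, fun l => ?_⟩
  obtain ⟨p, rfl⟩ : ∃ p, l = s - p := ⟨s - l, by ring⟩
  have h_point : y - s • (y - x) + (s - p) • (y - x) = y - p • (y - x) := by module
  rw [h_point]
  rcases lt_or_ge p 0 with hp | hp
  · have h_tri : ‖(1 - p) • y‖ ≤ ‖y - p • (y - x)‖ + ‖(-p) • x‖ := by
      have h_eq : (1 - p) • y = (y - p • (y - x)) + (-p) • x := by module
      rw [h_eq]
      exact norm_add_le _ _
    rw [norm_smul_of_nonneg (by linarith), norm_smul_of_nonneg (by linarith), h] at h_tri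
    linarith
  rcases le_or_gt p 1 with hp1 | hp1
  · exact hmin' p ⟨hp, hp1⟩
  · have h_tri : ‖p • x‖ ≤ ‖y - p • (y - x)‖ + ‖(p - 1) • y‖ := by
      have h_eq : p • x = (y - p • (y - x)) + (p - 1) • y := by module
      rw [h_eq]
      exact norm_add_le _ _
    rw [norm_smul_of_nonneg (by linarith), norm_smul_of_nonneg (by linarith), h] at h_tri
    linarith

/-- Birkhoff-James orthogonality is homogeneous. -/
lemma BJOrth.smul_smul {X : Type*} [NormedAddCommGroup X] [NormedSpace ℝ X] {u v : X}
    (h : BJOrth u v) (c d : ℝ) : BJOrth (c • u) (d • v) := by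
  intro l
  rcases eq_or_ne c 0 with rfl | hc
  · simp
  · have h_eq : c • u + l • d • v = c • (u + (l * d / c) • v) := by
      rw [smul_add, _root_.smul_smul, _root_.smul_smul, mul_div_cancel₀ _ hc]
    rw [h_eq, norm_smul, norm_smul]
    exact mul_le_mul_of_nonneg_left (h _) (norm_nonneg c)

/-- If `μ` is a rectangular bound for `X`, `t > 1`, `r > 0`, and
`‖x‖ = ‖y‖ = r`, then `‖y − x‖ + (t − 1)·‖y‖ ≤ μ·‖t·y − x‖`. -/
theorem rect_const_ball
    {X : Type*} [NormedAddCommGroup X] [NormedSpace ℝ X]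
    (μ : ℝ) (hμ : RectBound X μ)
    (t r : ℝ) (ht : 1 < t) (hr : 0 < r)
    (x y : X) (hx : ‖x‖ = r) (hy : ‖y‖ = r) :
    ‖y - x‖ + (t - 1) * ‖y‖ ≤ μ * ‖t • y - x‖ := by
  obtain ⟨s, hs, horth⟩ := exists_bjOrth_sub_of_norm_eq (hx.trans hy.symm)
  have ht' : 0 ≤ t - 1 := by linarith
  have hc : 0 ≤ 1 + (t - 1) * s := by positivity
  have h_bound := hμ _ _ (horth.smul_smul (t - 1) (1 + (t - 1) * s))
  have h_sum : (t - 1) • (y - s • (y - x)) + (1 + (t - 1) * s) • (y - x) = t • y - x := by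
    module
  rw [h_sum, norm_smul_of_nonneg ht', norm_smul_of_nonneg hc] at h_bound
  have h_tri : ‖y‖ ≤ ‖y - s • (y - x)‖ + s * ‖y - x‖ := by
    rw [← norm_smul_of_nonneg hs]
    exact norm_le_norm_sub_add _ _
  calc ‖y - x‖ + (t - 1) * ‖y‖
      ≤ ‖y - x‖ + (t - 1) * (‖y - s • (y - x)‖ + s * ‖y - x‖) := by gcongr
    _ = (t - 1) * ‖y - s • (y - x)‖ + (1 + (t - 1) * s) * ‖y - x‖ := by ring
    _ ≤ μ * ‖t • y - x‖ := h_bound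
end

section
/- Let X be a real normed vector space and μ ≥ 1 a real number that is simultaneously a rectangular bound for X and a radial Lipschitz bound for X. Let r ≥ 0, w, y ∈ X, and x ∈ X with ‖x − w‖ ≥ r. Define x̂ = w + ρ(x − w; r) and ŷ = w + ρ(y − w; r). Then ‖ŷ − x̂‖ + ‖y − ŷ‖ ≤ μ·‖y − x‖ + ‖x − x̂‖. -/
/-- `k` is a radial Lipschitz bound for `X`: the radial retraction of radius `r > 0`
is `k`-Lipschitz. -/
def RadialLipBound (X : Type*) [NormedAddCommGroup X] [NormedSpace ℝ X] (k : ℝ) : Prop :=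
  ∀ u v : X, ∀ r : ℝ, 0 < r → ‖radial u r - radial v r‖ ≤ k * ‖u - v‖

section Radial

variable {X : Type*} [NormedAddCommGroup X] [NormedSpace ℝ X]

theorem radial_of_norm_le {v : X} {r : ℝ} (h : ‖v‖ ≤ r) : radial v r = v := if_pos h

theorem radial_of_le_norm {v : X} {r : ℝ} (h : r ≤ ‖v‖) : radial v r = (r / ‖v‖) • v := by
  rcases h.eq_or_lt with rfl | h
  · rw [radial_of_norm_le le_rfl]
    rcases eq_or_ne v 0 with rfl | hv
    · simp
    · rw [div_self (norm_ne_zero_iff.2 hv), one_smul]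
  · exact if_neg h.not_ge

theorem radial_zero_right (v : X) : radial v 0 = 0 := by
  rw [radial_of_le_norm (norm_nonneg v), zero_div, zero_smul]

theorem norm_sub_radial {v : X} {r : ℝ} (hr : 0 ≤ r) (h : r ≤ ‖v‖) :
    ‖v - radial v r‖ = ‖v‖ - r := by
  rcases eq_or_ne v 0 with rfl | hv
  · obtain rfl : r = 0 := le_antisymm (by simpa using h) hr
    simp [radial_zero_right]
  · have hv' := norm_pos_iff.2 hv
    have : v - radial v r = ((‖v‖ - r) / ‖v‖) • v := by
      rw [radial_of_le_norm h, sub_div, div_self hv'.ne', sub_smul, one_smul]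
    rw [this, norm_smul, Real.norm_of_nonneg (div_nonneg (sub_nonneg.2 h) hv'.le),
      div_mul_cancel₀ _ hv'.ne']

/-- A radial Lipschitz bound also applies to the retraction of radius `0`. -/
theorem RadialLipBound.norm_radial_sub_le {k : ℝ} (h : RadialLipBound X k) (hk : 0 ≤ k)
    {r : ℝ} (hr : 0 ≤ r) (u v : X) : ‖radial u r - radial v r‖ ≤ k * ‖u - v‖ := by
  rcases hr.eq_or_lt with rfl | hr
  · simp only [radial_zero_right, sub_self, norm_zero]
    positivity
  · exact h u v r hr

/-- If `f` is a functional of norm `1` attaining its norm at `b`, then nonnegative multiples of `b`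
are Birkhoff-James orthogonal to the kernel of `f`. -/
theorem BJOrth.of_dual {f : StrongDual ℝ X} (hf : ‖f‖ = 1) {b v : X} (hb : f b = ‖b‖)
    (hv : f v = 0) {c : ℝ} (hc : 0 ≤ c) : BJOrth (c • b) v := fun l => by
  calc ‖c • b‖ = f (c • b + l • v) := by
        simp [norm_smul, hb, hv, abs_of_nonneg hc]
    _ ≤ ‖f (c • b + l • v)‖ := le_abs_self _
    _ ≤ ‖c • b + l • v‖ := by simpa [hf] using f.le_opNorm (c • b + l • v)

theorem RectBound.norm_radial_sub_add_le {μ : ℝ} (h : RectBound X μ) {a b : X}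
    (hab : ‖a‖ < ‖b‖) : ‖radial b ‖a‖ - a‖ + (‖b‖ - ‖a‖) ≤ μ * ‖b - a‖ := by
  have hb : 0 < ‖b‖ := (norm_nonneg a).trans_lt hab
  obtain ⟨f, hf, hfb⟩ := exists_dual_vector ℝ b hb.ne'
  replace hfb : f b = ‖b‖ := hfb
  have hfa : f a ≤ ‖a‖ := (le_abs_self _).trans (by simpa [hf] using f.le_opNorm a)
  have norm_smul_b {c : ℝ} (hc : 0 ≤ c) : ‖(c / ‖b‖) • b‖ = c := by
    rw [norm_smul, Real.norm_of_nonneg (div_nonneg hc hb.le), div_mul_cancel₀ _ hb.ne']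
  set k : X := (f a / ‖b‖) • b - a with hk
  have hfk : f k = 0 := by
    simp [hk, hfb, div_mul_cancel₀ _ hb.ne']
  have hrect := h (((‖b‖ - f a) / ‖b‖) • b) k
    (BJOrth.of_dual hf hfb hfk (div_nonneg (by linarith) hb.le))
  have hsum : ((‖b‖ - f a) / ‖b‖) • b + k = b - a := by
    rw [hk, sub_div, div_self hb.ne', sub_smul, one_smul]
    abel
  rw [hsum, norm_smul_b (by linarith)] at hrect
  have hproj : radial b ‖a‖ - a = ((‖a‖ - f a) / ‖b‖) • b + k := by
    rw [radial_of_le_norm hab.le, hk, sub_div, sub_smul]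
    abel
  have htri := norm_add_le (((‖a‖ - f a) / ‖b‖) • b) k
  rw [norm_smul_b (by linarith)] at htri
  rw [hproj]
  linarith

theorem norm_radial_sub_radial_le {a b : X} {r : ℝ} (hr : 0 ≤ r) (ha : r ≤ ‖a‖)
    (hab : ‖a‖ ≤ ‖b‖) : ‖radial b r - radial a r‖ ≤ ‖radial b ‖a‖ - a‖ := by
  rcases eq_or_ne a 0 with rfl | h0
  · obtain rfl : r = 0 := le_antisymm (by simpa using ha) hr
    simp [radial_zero_right]
  have ha0 := norm_pos_iff.2 h0
  have : radial b r - radial a r = (r / ‖a‖) • (radial b ‖a‖ - a) := by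
    rw [radial_of_le_norm ha, radial_of_le_norm (ha.trans hab), radial_of_le_norm hab, smul_sub,
      smul_smul, div_mul_div_cancel₀ ha0.ne']
  rw [this, norm_smul, Real.norm_of_nonneg (div_nonneg hr ha0.le)]
  exact mul_le_of_le_one_left (norm_nonneg _) ((div_le_one ha0).2 ha)

end Radial

/-- Let `μ ≥ 1` be simultaneously a rectangular bound and a radial
Lipschitz bound for `X`. Let `r ≥ 0`, `w, y ∈ X`, and `x ∈ X` with `‖x − w‖ ≥ r`.
With `xhat = w + ρ(x − w; r)` and `yhat = w + ρ(y − w; r)`,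
`‖yhat − xhat‖ + ‖y − yhat‖ ≤ μ·‖y − x‖ + ‖x − xhat‖`. -/
theorem ball_projection_lemma
    {X : Type*} [NormedAddCommGroup X] [NormedSpace ℝ X]
    (μ : ℝ) (hμ1 : 1 ≤ μ) (hrect : RectBound X μ) (hlip : RadialLipBound X μ)
    (r : ℝ) (hr : 0 ≤ r) (w y x : X) (hx : r ≤ ‖x - w‖)
    (xhat yhat : X)
    (hxhat : xhat = w + radial (x - w) r) (hyhat : yhat = w + radial (y - w) r) :
    ‖yhat - xhat‖ + ‖y - yhat‖ ≤ μ * ‖y - x‖ + ‖x - xhat‖ := by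
  subst hxhat hyhat
  have hμ0 : 0 ≤ μ := zero_le_one.trans hμ1
  obtain ⟨a, rfl⟩ : ∃ a, x = w + a := ⟨x - w, by abel⟩
  obtain ⟨b, rfl⟩ : ∃ b, y = w + b := ⟨y - w, by abel⟩
  simp only [add_sub_cancel_left, add_sub_add_left_eq_sub] at hx ⊢
  have hL := hlip.norm_radial_sub_le hμ0 hr b a
  rw [norm_sub_radial hr hx]
  rcases le_total ‖b‖ r with hb | hb
  · have : ‖b - radial b r‖ = 0 := by rw [radial_of_norm_le hb, sub_self, norm_zero]
    linarith
  · rw [norm_sub_radial hr hb]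
    rcases le_or_gt ‖b‖ ‖a‖ with hab | hab
    · linarith
    · have := norm_radial_sub_radial_le hr hx hab.le
      have := hrect.norm_radial_sub_add_le hab
      linarith
end

section
/- (Consistency of BdInterp.) Let X be a real normed vector space, T a positive integer, x_0 ∈ X, and f_1, …, f_T : X → ℝ convex functions with f_t ≥ 0 everywhere. Let x̃_0 = x_0, x̃_1, …, x̃_T and s_0 = x_0, s_1, …, s_T be sequences in X, let γ > 0 and δ > 0, set ε = 2γ + 2δ, and suppose there is D > 0 with ‖x̃_t − s_t‖ ≤ D for all 1 ≤ t ≤ T and that C_s(1, T) ≥ 1. Let x_0, x_1, …, x_T be the BdInterp sequence determined by these data. Then C_x(1, T) ≤ (1 + ε)·C_x̃(1, T). -/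
open scoped Classical

/-- The cost of the sequence `z` over times `a` through `b`:
`C_z(a, b) = Σ_{t=a}^{b} (f_t(z_t) + ‖z_t − z_{t−1}‖)`. -/
noncomputable def cost {X : Type*} [NormedAddCommGroup X]
    (f : ℕ → X → ℝ) (z : ℕ → X) (a b : ℕ) : ℝ :=
  ∑ t ∈ Finset.Icc a b, (f t (z t) + ‖z t - z (t - 1)‖)

/-- Retracting `v` to norm `max (‖v‖ - g) 0` rescales it and moves it by at most `g`. -/
theorem exists_radial_eq_smul {X : Type*} [NormedAddCommGroup X] [NormedSpace ℝ X]
    (v : X) {g : ℝ} (hg : 0 ≤ g) :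
    ∃ c : ℝ, 0 ≤ c ∧ c ≤ 1 ∧ radial v (max (‖v‖ - g) 0) = c • v ∧
      ‖c • v - v‖ ≤ g := by
  unfold radial
  split_ifs with h
  · exact ⟨1, zero_le_one, le_rfl, (one_smul ℝ v).symm, by simpa using hg⟩
  · push Not at h
    have hv : 0 < ‖v‖ := (le_max_right _ _).trans_lt h
    have hc : max (‖v‖ - g) 0 / ‖v‖ ≤ 1 := (div_le_one hv).2 h.le
    refine ⟨max (‖v‖ - g) 0 / ‖v‖, by positivity, hc, rfl, ?_⟩
    have hsub : (max (‖v‖ - g) 0 / ‖v‖) • v - v = (max (‖v‖ - g) 0 / ‖v‖ - 1) • v := by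
      rw [sub_smul, one_smul]
    rw [hsub, norm_smul, Real.norm_of_nonpos (by linarith), neg_sub, sub_mul,
      div_mul_cancel₀ _ hv.ne']
    linarith [le_max_left (‖v‖ - g) 0]

/-- Movement bound when both endpoints of a segment move, the interpolation weight is kept,
and the interpolated point is then perturbed by at most `g`. -/
theorem norm_sub_add_norm_sub_le_of_interpolation
    {X : Type*} [NormedAddCommGroup X] [NormedSpace ℝ X]
    {a s x a' s' x' : X} {ν g : ℝ} (hν0 : 0 ≤ ν) (hν1 : ν ≤ 1)
    (hx : x = s + ν • (a - s)) (hx' : ‖x' - (s' + ν • (a' - s'))‖ ≤ g) :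
    ‖x' - x‖ + ‖x' - a'‖ ≤ ‖x - a‖ + ‖a' - a‖ + 2 * ‖s' - s‖ + 2 * g := by
  set y := s' + ν • (a' - s') with hy
  have h1 : ‖y - x‖ ≤ ν * ‖a' - a‖ + (1 - ν) * ‖s' - s‖ := by
    have e : y - x = ν • (a' - a) + (1 - ν) • (s' - s) := by rw [hy, hx]; module
    rw [e]
    refine (norm_add_le _ _).trans_eq ?_
    rw [norm_smul, norm_smul, Real.norm_of_nonneg hν0, Real.norm_of_nonneg (sub_nonneg.2 hν1)]
  have h2 : ‖y - a'‖ ≤ ‖x - a‖ + ((1 - ν) * ‖s' - s‖ + (1 - ν) * ‖a' - a‖) := by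
    have e : y - a' = (x - a) + ((1 - ν) • (s' - s) - (1 - ν) • (a' - a)) := by
      rw [hy, hx]; module
    rw [e]
    refine (norm_add_le _ _).trans (add_le_add_right ((norm_sub_le _ _).trans_eq ?_) _)
    rw [norm_smul, norm_smul, Real.norm_of_nonneg (sub_nonneg.2 hν1)]
  have h3 := norm_sub_le_norm_sub_add_norm_sub x' y x
  have h4 := norm_sub_le_norm_sub_add_norm_sub x' y a'
  have h5 := mul_nonneg hν0 (norm_nonneg (s' - s))
  linarith

theorem cost_succ {X : Type*} [NormedAddCommGroup X] (f : ℕ → X → ℝ) (z : ℕ → X) (n : ℕ) :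
    cost f z 1 (n + 1) = cost f z 1 n + (f (n + 1) (z (n + 1)) + ‖z (n + 1) - z n‖) := by
  simp [cost, Finset.sum_Icc_succ_top]

/-- The normalised distance from `x` to `s` recovers the weight of `x` on the segment
from `s` to `a`. -/
theorem norm_ratio_mem_Icc_and_eq_interpolation
    {X : Type*} [NormedAddCommGroup X] [NormedSpace ℝ X] {a s x : X} {μ ν : ℝ}
    (hμ0 : 0 ≤ μ) (hμ1 : μ ≤ 1) (hx : x = s + μ • (a - s))
    (hν : ν = if a = s then 0 else ‖x - s‖ / ‖a - s‖) :
    0 ≤ ν ∧ ν ≤ 1 ∧ x = s + ν • (a - s) := by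
  split_ifs at hν with h
  · subst hν h
    simpa using hx
  · have hpos : 0 < ‖a - s‖ := norm_pos_iff.2 (sub_ne_zero.2 h)
    have : ν = μ := by
      rw [hν, hx, add_sub_cancel_left, norm_smul, Real.norm_of_nonneg hμ0,
        mul_div_cancel_right₀ _ hpos.ne']
    subst this
    exact ⟨hμ0, hμ1, hx⟩

/-- **Consistency of BdInterp.** Given convex nonnegative hitting costs
`f_1, …, f_T`, an advice sequence `adv` and a robust sequence `s` (both starting at
`x₀`) that are `D`-bounded, with `C_s(1, T) ≥ 1`, and parameters `γ, δ > 0` with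
`ε = 2γ + 2δ`, the BdInterp sequence `x` satisfies `C_x(1, T) ≤ (1 + ε)·C_adv(1, T)`. -/
theorem bdinterp_consistency
    {X : Type*} [NormedAddCommGroup X] [NormedSpace ℝ X]
    (T : ℕ) (hT : 1 ≤ T) (x₀ : X) (f : ℕ → X → ℝ)
    (hconv : ∀ t ∈ Finset.Icc 1 T, ConvexOn ℝ Set.univ (f t))
    (hnn : ∀ t ∈ Finset.Icc 1 T, ∀ p : X, 0 ≤ f t p)
    (adv s x : ℕ → X)
    (hadv0 : adv 0 = x₀) (hs0 : s 0 = x₀) (hx0 : x 0 = x₀)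
    (γ δ ε : ℝ) (hγ : 0 < γ) (hδ : 0 < δ) (hε : ε = 2 * γ + 2 * δ)
    (D : ℝ) (hD : 0 < D) (hbdd : ∀ t ∈ Finset.Icc 1 T, ‖adv t - s t‖ ≤ D)
    (hrob1 : 1 ≤ cost f s 1 T)
    (hstep : ∀ t ∈ Finset.Icc 1 T,
      x t =
        if δ * cost f adv 1 t ≤ cost f s 1 t then adv t
        else
          let Δ := f t (adv t) + ‖adv t - adv (t - 1)‖
          let ν : ℝ :=
            if adv (t - 1) = s (t - 1) then 0
            else ‖x (t - 1) - s (t - 1)‖ / ‖adv (t - 1) - s (t - 1)‖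
          let y := ν • adv t + (1 - ν) • s t
          s t + radial (y - s t) (max (‖y - s t‖ - γ * Δ) 0)) :
    cost f x 1 T ≤ (1 + ε) * cost f adv 1 T := by
  -- The distance from `x n` to the advice serves as a potential.
  have key : ∀ n ≤ T,
      (∃ μ : ℝ, 0 ≤ μ ∧ μ ≤ 1 ∧ x n = s n + μ • (adv n - s n)) ∧
      cost f x 1 n + ‖x n - adv n‖ ≤ (1 + 2 * γ) * cost f adv 1 n + 2 * cost f s 1 n ∧
      cost f x 1 n + ‖x n - adv n‖ ≤ (1 + 2 * γ + 2 * δ) * cost f adv 1 n := by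
    intro n
    induction n with
    | zero =>
      intro _
      exact ⟨⟨0, le_rfl, zero_le_one, by simp [hx0, hs0]⟩, by simp [cost, hx0, hadv0],
        by simp [cost, hx0, hadv0]⟩
    | succ n ih =>
      intro hn
      obtain ⟨⟨μ, hμ0, hμ1, hμ⟩, hP, hQ⟩ := ih (by omega)
      have hmem : n + 1 ∈ Finset.Icc 1 T := Finset.mem_Icc.2 ⟨by omega, hn⟩
      have hxs := hstep (n + 1) hmem
      have hfa := hnn (n + 1) hmem (adv (n + 1))
      have hfs := hnn (n + 1) hmem (s (n + 1))
      have hda := norm_nonneg (adv (n + 1) - adv n)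
      have hds := norm_nonneg (s (n + 1) - s n)
      set Δ := f (n + 1) (adv (n + 1)) + ‖adv (n + 1) - adv n‖ with hΔ
      have hΔ0 : 0 ≤ Δ := add_nonneg hfa hda
      have hγΔ : 0 ≤ γ * Δ := mul_nonneg hγ.le hΔ0
      have hδΔ : 0 ≤ δ * Δ := mul_nonneg hδ.le hΔ0
      have hcx := cost_succ f x n
      have hca : cost f adv 1 (n + 1) = cost f adv 1 n + Δ := cost_succ f adv n
      have hcs := cost_succ f s n
      simp only [Nat.add_sub_cancel, ← hΔ] at hxs
      by_cases hif : δ * cost f adv 1 (n + 1) ≤ cost f s 1 (n + 1)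
      · rw [if_pos hif] at hxs
        have htri := norm_sub_le_norm_sub_add_norm_sub (adv (n + 1)) (adv n) (x n)
        rw [norm_sub_rev (adv n) (x n)] at htri
        refine ⟨⟨1, zero_le_one, le_rfl, by rw [hxs]; module⟩, ?_, ?_⟩
        · rw [hcx, hca, hcs, hxs, sub_self, norm_zero]
          linarith
        · rw [hcx, hca, hxs, sub_self, norm_zero]
          linarith
      · rw [if_neg hif] at hxs
        push Not at hif
        generalize hν : (if adv n = s n then (0 : ℝ) else ‖x n - s n‖ / ‖adv n - s n‖) = ν at hxs
        obtain ⟨hν0, hν1, hxn⟩ :=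
          norm_ratio_mem_Icc_and_eq_interpolation hμ0 hμ1 hμ hν.symm
        have hy : ν • adv (n + 1) + (1 - ν) • s (n + 1) - s (n + 1)
            = ν • (adv (n + 1) - s (n + 1)) := by module
        rw [hy] at hxs
        obtain ⟨c, hc0, hc1, hc, hcg⟩ :=
          exists_radial_eq_smul (ν • (adv (n + 1) - s (n + 1))) hγΔ
        rw [hc] at hxs
        have hκ0 : 0 ≤ c * ν := mul_nonneg hc0 hν0
        have hκ1 : c * ν ≤ 1 := mul_le_one₀ hc1 hν0 hν1
        have hmove := norm_sub_add_norm_sub_le_of_interpolation (a' := adv (n + 1))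
          (s' := s (n + 1)) (x' := x (n + 1)) (g := γ * Δ) hν0 hν1 hxn
          (by rwa [hxs, add_sub_add_left_eq_sub])
        have hxκ : x (n + 1) = (c * ν) • adv (n + 1) + (1 - c * ν) • s (n + 1) := by
          rw [hxs]; module
        have hhit : f (n + 1) (x (n + 1))
            ≤ f (n + 1) (adv (n + 1)) + f (n + 1) (s (n + 1)) := by
          have hcv := (hconv (n + 1) hmem).2 (Set.mem_univ (adv (n + 1)))
            (Set.mem_univ (s (n + 1))) hκ0 (sub_nonneg.2 hκ1) (by ring)
          rw [← hxκ, smul_eq_mul, smul_eq_mul] at hcv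
          linarith [mul_le_of_le_one_left hfa hκ1,
            mul_le_of_le_one_left hfs (show 1 - c * ν ≤ 1 by linarith)]
        have hP' : cost f x 1 (n + 1) + ‖x (n + 1) - adv (n + 1)‖
            ≤ (1 + 2 * γ) * cost f adv 1 (n + 1) + 2 * cost f s 1 (n + 1) := by
          rw [hcx, hca, hcs]
          linarith
        exact ⟨⟨c * ν, hκ0, hκ1, by rw [hxκ]; module⟩, hP', by linarith⟩
  rw [hε, ← add_assoc]
  linarith [(key T le_rfl).2.2, norm_nonneg (x T - adv T)]
end

section
/- (Competitiveness of Switch with respect to the advice.) Let X be a real normed vector space, T a positive integer, x_0 ∈ X, and f_1, …, f_T : X → ℝ convex functions with f_t ≥ 0 everywhere. Let Adv_0 = Rob_0 = x_0 and let Adv_1, …, Adv_T and Rob_1, …, Rob_T be sequences in X with C_Rob(1, T) ≥ 1. Let b > 1 and δ ∈ (0, 1], and let x_1, …, x_T be the Switch sequence determined by these data. Then C_x(1, T) ≤ (1 + 2·(b² + δ·b³)/(b² − 1))·C_Adv(1, T). -/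
open scoped Classical

/-- `ell f Adv Rob T b δ i` is the largest `t ∈ {1, …, T}` with `C_Adv(1, t) ≤ b^i`
when `i` is even, respectively `C_Rob(1, t) ≤ δ·b^i` when `i` is odd (and `0` if no
such `t` exists). -/
noncomputable def ell {X : Type*} [NormedAddCommGroup X]
    (f : ℕ → X → ℝ) (Adv Rob : ℕ → X) (T : ℕ) (b δ : ℝ) (i : ℕ) : ℕ :=
  if Even i then
    ((Finset.Icc 1 T).filter fun t => cost f Adv 1 t ≤ b ^ i).sup id
  else
    ((Finset.Icc 1 T).filter fun t => cost f Rob 1 t ≤ δ * b ^ i).sup id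

/-- `mSeq … i` is `m_{i−1}` of the Switch phase construction: `m_{−1} = 0` and
`m_i = max(m_{i−1}, ℓ_i)`, so that phase `i` consists of the times
`mSeq … i < t ≤ mSeq … (i+1)`. -/
noncomputable def mSeq {X : Type*} [NormedAddCommGroup X]
    (f : ℕ → X → ℝ) (Adv Rob : ℕ → X) (T : ℕ) (b δ : ℝ) : ℕ → ℕ
  | 0 => 0
  | i + 1 => max (mSeq f Adv Rob T b δ i) (ell f Adv Rob T b δ i)

section Switch

variable {X : Type*} [NormedAddCommGroup X]

theorem cost_one_zero (f : ℕ → X → ℝ) (z : ℕ → X) : cost f z 1 0 = 0 := by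
  simp [cost]

theorem cost_one_succ (f : ℕ → X → ℝ) (z : ℕ → X) (t : ℕ) :
    cost f z 1 (t + 1) = cost f z 1 t + (f (t + 1) (z (t + 1)) + ‖z (t + 1) - z t‖) := by
  simp [cost, Finset.sum_Icc_succ_top]

/-- With nonnegative hitting costs, the cost dominates the distance travelled. -/
theorem norm_sub_zero_le_cost {f : ℕ → X → ℝ} {T : ℕ}
    (hnn : ∀ t ∈ Finset.Icc 1 T, ∀ p : X, 0 ≤ f t p) (z : ℕ → X) {t : ℕ} (ht : t ≤ T) :
    ‖z t - z 0‖ ≤ cost f z 1 t := by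
  induction t with
  | zero => simp [cost_one_zero]
  | succ t ih =>
    rw [cost_one_succ]
    have h1 := ih (by omega)
    have h2 := hnn (t + 1) (Finset.mem_Icc.2 ⟨by omega, ht⟩) (z (t + 1))
    have h3 := norm_sub_le_norm_sub_add_norm_sub (z (t + 1)) (z t) (z 0)
    linarith

/-- While `x` follows `z`, its cost exceeds the increase of the cost of `z` by at most the
initial distance between the two sequences. -/
theorem cost_add_norm_sub_le_of_follow (f : ℕ → X → ℝ) {x z : ℕ → X} {s t : ℕ} (hst : s ≤ t)
    (hx : ∀ u, s < u → u ≤ t → x u = z u) :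
    cost f x 1 t + ‖x t - z t‖ + cost f z 1 s ≤
      cost f x 1 s + ‖x s - z s‖ + cost f z 1 t := by
  induction t, hst using Nat.le_induction with
  | base => exact le_rfl
  | succ t hst ih =>
    have h1 := ih fun u hu hut => hx u hu (by omega)
    have h2 := hx (t + 1) (by omega) le_rfl
    have h3 := norm_sub_le_norm_sub_add_norm_sub (z (t + 1)) (z t) (x t)
    rw [norm_sub_rev (z t)] at h3
    rw [cost_one_succ, cost_one_succ, h2, sub_self, norm_zero]
    linarith

/-- The sequence that Switch follows during phase `i`. -/
def phaseSeq (Adv Rob : ℕ → X) (i : ℕ) : ℕ → X :=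
  if Even i then Adv else Rob

/-- The bound on the cost of `phaseSeq Adv Rob i` that ends phase `i`. -/
noncomputable def phaseBudget (b δ : ℝ) (i : ℕ) : ℝ :=
  if Even i then b ^ i else δ * b ^ i

theorem phaseBudget_nonneg {b δ : ℝ} (hb : 0 ≤ b) (hδ : 0 ≤ δ) (i : ℕ) :
    0 ≤ phaseBudget b δ i := by
  unfold phaseBudget
  split_ifs <;> positivity

theorem ell_eq_sup (f : ℕ → X → ℝ) (Adv Rob : ℕ → X) (T : ℕ) (b δ : ℝ) (i : ℕ) :
    ell f Adv Rob T b δ i = ((Finset.Icc 1 T).filter fun t =>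
      cost f (phaseSeq Adv Rob i) 1 t ≤ phaseBudget b δ i).sup id := by
  unfold ell phaseSeq phaseBudget
  split_ifs <;> rfl

theorem le_ell {f : ℕ → X → ℝ} {Adv Rob : ℕ → X} {T : ℕ} {b δ : ℝ} {i t : ℕ}
    (ht : t ∈ Finset.Icc 1 T) (h : cost f (phaseSeq Adv Rob i) 1 t ≤ phaseBudget b δ i) :
    t ≤ ell f Adv Rob T b δ i := by
  rw [ell_eq_sup]
  exact Finset.le_sup (f := id) (Finset.mem_filter.2 ⟨ht, h⟩)

theorem ell_le (f : ℕ → X → ℝ) (Adv Rob : ℕ → X) (T : ℕ) (b δ : ℝ) (i : ℕ) :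
    ell f Adv Rob T b δ i ≤ T := by
  rw [ell_eq_sup]
  exact Finset.sup_le fun t ht => (Finset.mem_Icc.1 (Finset.mem_filter.1 ht).1).2

theorem cost_ell_le {f : ℕ → X → ℝ} {Adv Rob : ℕ → X} {T : ℕ} {b δ : ℝ} {i : ℕ}
    (h : 0 < ell f Adv Rob T b δ i) :
    cost f (phaseSeq Adv Rob i) 1 (ell f Adv Rob T b δ i) ≤ phaseBudget b δ i := by
  rw [ell_eq_sup] at h ⊢
  have hne : ((Finset.Icc 1 T).filter fun t =>
      cost f (phaseSeq Adv Rob i) 1 t ≤ phaseBudget b δ i).Nonempty := by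
    by_contra hne
    rw [Finset.not_nonempty_iff_eq_empty.1 hne] at h
    simp at h
  obtain ⟨t, ht, hteq⟩ := Finset.exists_mem_eq_sup _ hne id
  rw [hteq]
  exact (Finset.mem_filter.1 ht).2

theorem mSeq_mono (f : ℕ → X → ℝ) (Adv Rob : ℕ → X) (T : ℕ) (b δ : ℝ) :
    Monotone (mSeq f Adv Rob T b δ) :=
  monotone_nat_of_le_succ fun _ => le_max_left _ _

theorem ell_le_mSeq_succ (f : ℕ → X → ℝ) (Adv Rob : ℕ → X) (T : ℕ) (b δ : ℝ) (i : ℕ) :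
    ell f Adv Rob T b δ i ≤ mSeq f Adv Rob T b δ (i + 1) :=
  le_max_right _ _

theorem mSeq_le (f : ℕ → X → ℝ) (Adv Rob : ℕ → X) (T : ℕ) (b δ : ℝ) (i : ℕ) :
    mSeq f Adv Rob T b δ i ≤ T := by
  induction i with
  | zero => exact Nat.zero_le _
  | succ i ih => exact max_le ih (ell_le f Adv Rob T b δ i)

theorem cost_mSeq_succ_le {f : ℕ → X → ℝ} {Adv Rob : ℕ → X} {T : ℕ} {b δ : ℝ} {i : ℕ}
    (h : mSeq f Adv Rob T b δ i < mSeq f Adv Rob T b δ (i + 1)) :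
    cost f (phaseSeq Adv Rob i) 1 (mSeq f Adv Rob T b δ (i + 1)) ≤ phaseBudget b δ i := by
  have hlt : mSeq f Adv Rob T b δ i < ell f Adv Rob T b δ i := by
    simpa [mSeq] using h
  have heq : mSeq f Adv Rob T b δ (i + 1) = ell f Adv Rob T b δ i := max_eq_right hlt.le
  rw [heq]
  exact cost_ell_le (by omega)

theorem phaseBudget_lt_cost_of_mSeq_lt {f : ℕ → X → ℝ} {Adv Rob : ℕ → X} {T : ℕ} {b δ : ℝ}
    {i k : ℕ} (hik : i < k) (h : mSeq f Adv Rob T b δ k < T) :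
    phaseBudget b δ i < cost f (phaseSeq Adv Rob i) 1 T := by
  by_contra! hle
  have h1 := le_ell (Finset.mem_Icc.2 ⟨by omega, le_rfl⟩) hle
  have h2 := ell_le_mSeq_succ f Adv Rob T b δ i
  have h3 := mSeq_mono f Adv Rob T b δ (Nat.succ_le_of_lt hik)
  simp only [Nat.succ_eq_add_one] at h3
  omega

theorem exists_last_phase (f : ℕ → X → ℝ) (Adv Rob : ℕ → X) {T : ℕ} (hT : 1 ≤ T) {b : ℝ}
    (hb : 1 < b) (δ : ℝ) :
    ∃ k, mSeq f Adv Rob T b δ k < T ∧ mSeq f Adv Rob T b δ (k + 1) = T := by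
  have hex : ∃ k, mSeq f Adv Rob T b δ k = T := by
    by_contra! hne
    obtain ⟨n, hn⟩ := pow_unbounded_of_one_lt (cost f Adv 1 T) hb
    have h := phaseBudget_lt_cost_of_mSeq_lt (Nat.lt_succ_self (2 * n))
      (lt_of_le_of_ne (mSeq_le f Adv Rob T b δ _) (hne _))
    simp only [phaseBudget, phaseSeq, even_two_mul, if_true] at h
    have := pow_le_pow_right₀ hb.le (show n ≤ 2 * n by omega)
    linarith
  have h0 : Nat.find hex ≠ 0 := by
    intro h
    have := Nat.find_spec hex
    rw [h] at this
    simp only [mSeq] at this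
    omega
  obtain ⟨k, hk⟩ := Nat.exists_eq_succ_of_ne_zero h0
  refine ⟨k, lt_of_le_of_ne (mSeq_le f Adv Rob T b δ k) (Nat.find_min hex (by omega)), ?_⟩
  have := Nat.find_spec hex
  rwa [hk] at this

/-- At the start of phase `i`, the cost of Switch plus the price of moving to either reference
sequence exceeds the cost of that sequence by at most twice the sum of the earlier budgets. -/
theorem cost_add_norm_sub_phaseSeq_le {T : ℕ} {f : ℕ → X → ℝ}
    (hnn : ∀ t ∈ Finset.Icc 1 T, ∀ p : X, 0 ≤ f t p) {Adv Rob x : ℕ → X}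
    (hAdv : Adv 0 = x 0) (hRob : Rob 0 = x 0) {b δ : ℝ} (hb : 0 ≤ b) (hδ : 0 ≤ δ)
    (hx : ∀ i t, mSeq f Adv Rob T b δ i < t → t ≤ mSeq f Adv Rob T b δ (i + 1) →
      x t = phaseSeq Adv Rob i t) (i j : ℕ) :
    cost f x 1 (mSeq f Adv Rob T b δ i) +
        ‖x (mSeq f Adv Rob T b δ i) - phaseSeq Adv Rob j (mSeq f Adv Rob T b δ i)‖ ≤
      cost f (phaseSeq Adv Rob j) 1 (mSeq f Adv Rob T b δ i) +
        2 * ∑ l ∈ Finset.range i, phaseBudget b δ l := by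
  have hstart : ∀ j, phaseSeq Adv Rob j 0 = x 0 := fun j => by
    unfold phaseSeq
    split_ifs <;> assumption
  induction i generalizing j with
  | zero => simp [mSeq, cost_one_zero, hstart]
  | succ i ih =>
    rw [Finset.sum_range_succ]
    have hm : mSeq f Adv Rob T b δ i ≤ mSeq f Adv Rob T b δ (i + 1) := le_max_left _ _
    rcases hm.eq_or_lt with heq | hlt
    · rw [← heq]
      linarith [ih j, phaseBudget_nonneg hb hδ i]
    · have h1 := cost_add_norm_sub_le_of_follow f hm (hx i)
      have h2 := ih i
      have h3 := cost_mSeq_succ_le hlt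
      have hT := mSeq_le f Adv Rob T b δ (i + 1)
      have h4 := norm_sub_zero_le_cost hnn (phaseSeq Adv Rob i) hT
      have h5 := norm_sub_zero_le_cost hnn (phaseSeq Adv Rob j) hT
      rw [hx i _ hlt le_rfl] at h1 ⊢
      rw [hstart] at h4 h5
      have h6 := norm_sub_le_norm_sub_add_norm_sub
        (phaseSeq Adv Rob i (mSeq f Adv Rob T b δ (i + 1))) (x 0)
        (phaseSeq Adv Rob j (mSeq f Adv Rob T b δ (i + 1)))
      rw [norm_sub_rev (x 0)] at h6
      rw [sub_self, norm_zero] at h1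
      linarith

theorem sum_phaseBudget_even (b δ : ℝ) (n : ℕ) :
    (b ^ 2 - 1) * ∑ l ∈ Finset.range (2 * n), phaseBudget b δ l =
      (1 + δ * b) * (b ^ (2 * n) - 1) := by
  induction n with
  | zero => simp
  | succ n ih =>
    have h1 : phaseBudget b δ (2 * n) = b ^ (2 * n) := if_pos (even_two_mul n)
    have h2 : phaseBudget b δ (2 * n + 1) = δ * b ^ (2 * n + 1) :=
      if_neg (Nat.not_even_two_mul_add_one n)
    rw [show 2 * (n + 1) = 2 * n + 1 + 1 by ring, Finset.sum_range_succ,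
      Finset.sum_range_succ, mul_add, mul_add, ih, h1, h2]
    ring

end Switch

/-- **Competitiveness of Switch w.r.t. the advice.** With convex
nonnegative hitting costs, sequences `Adv`, `Rob` starting at `x₀` with
`C_Rob(1, T) ≥ 1`, parameters `b > 1`, `δ ∈ (0, 1]`, the Switch sequence `x`
(following `Adv` during even phases and `Rob` during odd phases) satisfies
`C_x(1, T) ≤ (1 + 2(b² + δb³)/(b² − 1))·C_Adv(1, T)`. -/
theorem switch_consistency
    {X : Type*} [NormedAddCommGroup X] [NormedSpace ℝ X]
    (T : ℕ) (hT : 1 ≤ T) (x₀ : X) (f : ℕ → X → ℝ)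
    (hconv : ∀ t ∈ Finset.Icc 1 T, ConvexOn ℝ Set.univ (f t))
    (hnn : ∀ t ∈ Finset.Icc 1 T, ∀ p : X, 0 ≤ f t p)
    (Adv Rob x : ℕ → X)
    (hAdv0 : Adv 0 = x₀) (hRob0 : Rob 0 = x₀) (hx0 : x 0 = x₀)
    (hRob1 : 1 ≤ cost f Rob 1 T)
    (b δ : ℝ) (hb : 1 < b) (hδ0 : 0 < δ) (hδ1 : δ ≤ 1)
    (hstep : ∀ t ∈ Finset.Icc 1 T, ∀ i : ℕ,
      mSeq f Adv Rob T b δ i < t → t ≤ mSeq f Adv Rob T b δ (i + 1) →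
      x t = if Even i then Adv t else Rob t) :
    cost f x 1 T ≤ (1 + 2 * (b ^ 2 + δ * b ^ 3) / (b ^ 2 - 1)) * cost f Adv 1 T := by
  have hb2 : 0 < b ^ 2 - 1 := by nlinarith
  have hx : ∀ i t, mSeq f Adv Rob T b δ i < t → t ≤ mSeq f Adv Rob T b δ (i + 1) →
      x t = phaseSeq Adv Rob i t := fun i t h1 h2 => by
    rw [hstep t (Finset.mem_Icc.2 ⟨by omega, h2.trans (mSeq_le f Adv Rob T b δ _)⟩) i h1 h2]
    unfold phaseSeq
    split_ifs <;> rfl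
  obtain ⟨k, hk, hkT⟩ := exists_last_phase f Adv Rob hT hb δ
  have hinv := cost_add_norm_sub_phaseSeq_le hnn (hAdv0.trans hx0.symm) (hRob0.trans hx0.symm)
    (by linarith) hδ0.le hx k k
  have hfollow := cost_add_norm_sub_le_of_follow f (hk.trans_eq hkT.symm).le (hx k)
  have hbudget := cost_mSeq_succ_le (hk.trans_eq hkT.symm)
  rw [hkT] at hfollow hbudget
  have hcost : cost f x 1 T ≤ cost f (phaseSeq Adv Rob k) 1 T +
      2 * ∑ l ∈ Finset.range k, phaseBudget b δ l := by
    linarith [norm_nonneg (x T - phaseSeq Adv Rob k T)]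
  have hA : 0 ≤ cost f Adv 1 T :=
    (norm_nonneg _).trans (norm_sub_zero_le_cost hnn Adv le_rfl)
  have hlow : ∀ n, 2 * n < k → b ^ (2 * n) < cost f Adv 1 T := fun n hn => by
    simpa [phaseBudget, phaseSeq] using phaseBudget_lt_cost_of_mSeq_lt hn hk
  rw [one_add_mul, mul_div_assoc, mul_assoc, div_mul_eq_mul_div]
  rcases Nat.even_or_odd' k with ⟨n, rfl | rfl⟩
  · have hS : ∑ l ∈ Finset.range (2 * n), phaseBudget b δ l ≤
        (b ^ 2 + δ * b ^ 3) * cost f Adv 1 T / (b ^ 2 - 1) := by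
      rw [le_div_iff₀ hb2, mul_comm, sum_phaseBudget_even]
      rcases n with _ | n
      · simp only [mul_zero, pow_zero, sub_self]
        positivity
      · have h := hlow n (by omega)
        calc (1 + δ * b) * (b ^ (2 * (n + 1)) - 1) ≤ (1 + δ * b) * b ^ (2 * (n + 1)) := by
              gcongr
              linarith
          _ = (b ^ 2 + δ * b ^ 3) * b ^ (2 * n) := by ring
          _ ≤ _ := by gcongr
    simp only [phaseSeq, even_two_mul, if_true] at hcost
    linarith
  · have h := hlow n (by omega)
    have hS : phaseBudget b δ (2 * n + 1) / 2 +
        ∑ l ∈ Finset.range (2 * n + 1), phaseBudget b δ l ≤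
        (b ^ 2 + δ * b ^ 3) * cost f Adv 1 T / (b ^ 2 - 1) := by
      have h1 : phaseBudget b δ (2 * n) = b ^ (2 * n) := if_pos (even_two_mul n)
      have h2 : phaseBudget b δ (2 * n + 1) = δ * b ^ (2 * n + 1) :=
        if_neg (Nat.not_even_two_mul_add_one n)
      have h3 := sum_phaseBudget_even b δ n
      have h4 : (b ^ 2 + δ * b ^ 3) * b ^ (2 * n) ≤ (b ^ 2 + δ * b ^ 3) * cost f Adv 1 T := by
        gcongr
      have h5 : 0 ≤ δ * b * b ^ (2 * n) * (b ^ 2 - 1) := by positivity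
      have h6 : 0 < δ * b := by positivity
      rw [le_div_iff₀ hb2, Finset.sum_range_succ, h1, h2, pow_succ]
      linarith
    linarith
end

section
/- (Lower bound for switching algorithms.) For every real c < 3 there exists a dimension d (which may be taken a perfect square) such that the following holds in ℝ^d with the Euclidean norm: for every real b, every advice-agnostic b-competitive deterministic online CBC algorithm Rob, and every algorithm Alg that switches between advice and Rob, if Alg is c-consistent then there is no real R for which Alg is R-robust. -/
open scoped Classical

noncomputable section

/-- `d`-dimensional Euclidean space. -/
abbrev Euc (d : ℕ) := EuclideanSpace ℝ (Fin d)

/-- A "good body": a nonempty closed convex subset. -/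
def GoodBody {d : ℕ} (K : Set (Euc d)) : Prop :=
  K.Nonempty ∧ IsClosed K ∧ Convex ℝ K

/-- A convex body chasing instance: a starting point together with a finite sequence
`K_1, …, K_T` of nonempty closed convex bodies. -/
structure CBCInstance (d : ℕ) where
  x0 : Euc d
  T : ℕ
  hT : 1 ≤ T
  K : ℕ → Set (Euc d)
  hK : ∀ t ∈ Finset.Icc 1 T, GoodBody (K t)

/-- A sequence `z` is feasible for the instance `I` if it starts at `I.x0` and
`z t ∈ K t` for `1 ≤ t ≤ T`. -/
def Feasible {d : ℕ} (I : CBCInstance d) (z : ℕ → Euc d) : Prop :=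
  z 0 = I.x0 ∧ ∀ t ∈ Finset.Icc 1 I.T, z t ∈ I.K t

/-- Movement cost of a sequence on an instance. -/
def moveCost {d : ℕ} (I : CBCInstance d) (z : ℕ → Euc d) : ℝ :=
  ∑ t ∈ Finset.Icc 1 I.T, ‖z t - z (t - 1)‖

/-- The optimal (offline) cost of an instance. -/
def COpt {d : ℕ} (I : CBCInstance d) : ℝ :=
  sInf {c : ℝ | ∃ z : ℕ → Euc d, Feasible I z ∧ c = moveCost I z}

/-- The prefix `(K_1, …, K_t)` of the bodies of an instance, as a list. -/
def prefixBodies {d : ℕ} (I : CBCInstance d) (t : ℕ) : List (Set (Euc d)) :=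
  (List.range t).map fun i => I.K (i + 1)

/-- The prefix `(ã_1, …, ã_t)` of an advice sequence, as a list. -/
def prefixAdvice {d : ℕ} (adv : ℕ → Euc d) (t : ℕ) : List (Euc d) :=
  (List.range t).map fun i => adv (i + 1)

/-- A deterministic, advice-agnostic online CBC algorithm assigns to each starting
point and each nonempty finite sequence of nonempty closed convex bodies a point of
the last body. `OnlineCBCAlg A` says `A` is feasible in this sense. -/
def OnlineCBCAlg {d : ℕ} (A : Euc d → List (Set (Euc d)) → Euc d) : Prop :=
  ∀ (x0 : Euc d) (L : List (Set (Euc d))) (K : Set (Euc d)),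
    (∀ B ∈ L ++ [K], GoodBody B) → A x0 (L ++ [K]) ∈ K

/-- The decisions of an online algorithm `A` on the instance `I`:
`a_t = A(x0; K_1, …, K_t)` for `t ≥ 1`, with `a_0 = x0`. -/
def robDecisions {d : ℕ} (A : Euc d → List (Set (Euc d)) → Euc d)
    (I : CBCInstance d) (t : ℕ) : Euc d :=
  if t = 0 then I.x0 else A I.x0 (prefixBodies I t)

/-- `A` is `b`-competitive: on every instance its cost is at most `b·C_Opt`. -/
def Competitive {d : ℕ} (A : Euc d → List (Set (Euc d)) → Euc d) (b : ℝ) : Prop :=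
  ∀ I : CBCInstance d, moveCost I (robDecisions A I) ≤ b * COpt I

/-- `Alg` switches between advice and `Rob`: given the starting point, the bodies
served so far and the advice points so far, it outputs either the current advice point
or the decision of `Rob`. -/
def SwitchesBetween {d : ℕ}
    (Alg : Euc d → List (Set (Euc d)) → List (Euc d) → Euc d)
    (Rob : Euc d → List (Set (Euc d)) → Euc d) : Prop :=
  ∀ (x0 : Euc d) (L : List (Set (Euc d))) (adv : List (Euc d)) (h : adv ≠ []),
    Alg x0 L adv = adv.getLast h ∨ Alg x0 L adv = Rob x0 L

/-- The decisions of a switching algorithm on an instance `I` with advice `adv`. -/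
def algDecisions {d : ℕ}
    (Alg : Euc d → List (Set (Euc d)) → List (Euc d) → Euc d)
    (I : CBCInstance d) (adv : ℕ → Euc d) (t : ℕ) : Euc d :=
  if t = 0 then I.x0 else Alg I.x0 (prefixBodies I t) (prefixAdvice adv t)

/-- `Alg` is `c`-consistent: on every instance and every (feasible) advice, its cost
is at most `c` times the advice's cost. -/
def Consistent {d : ℕ}
    (Alg : Euc d → List (Set (Euc d)) → List (Euc d) → Euc d) (c : ℝ) : Prop :=
  ∀ (I : CBCInstance d) (adv : ℕ → Euc d), Feasible I adv →
    moveCost I (algDecisions Alg I adv) ≤ c * moveCost I adv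

/-- `Alg` is `R`-robust: on every instance and every (feasible) advice, its cost is
at most `R·C_Opt`. -/
def Robust {d : ℕ}
    (Alg : Euc d → List (Set (Euc d)) → List (Euc d) → Euc d) (R : ℝ) : Prop :=
  ∀ (I : CBCInstance d) (adv : ℕ → Euc d), Feasible I adv →
    moveCost I (algDecisions Alg I adv) ≤ R * COpt I

section PathCost

variable {X : Type*} [PseudoMetricSpace X]

/-- The length of the first `n` steps of a sequence. -/
def pathCost (z : ℕ → X) (n : ℕ) : ℝ :=
  ∑ i ∈ Finset.range n, dist (z i) (z (i + 1))

lemma pathCost_succ (z : ℕ → X) (n : ℕ) :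
    pathCost z (n + 1) = pathCost z n + dist (z n) (z (n + 1)) :=
  Finset.sum_range_succ _ _

lemma pathCost_add_dist_le (z : ℕ → X) {m n : ℕ} (h : m ≤ n) :
    pathCost z m + dist (z m) (z n) ≤ pathCost z n := by
  unfold pathCost
  rw [← Finset.sum_range_add_sum_Ico _ h]
  gcongr
  exact dist_le_Ico_sum_dist z h

lemma dist_le_pathCost (z : ℕ → X) (n : ℕ) : dist (z 0) (z n) ≤ pathCost z n := by
  simpa [pathCost] using pathCost_add_dist_le z (Nat.zero_le n)

lemma pathCost_congr {z z' : ℕ → X} {n : ℕ} (h : ∀ t ≤ n, z t = z' t) :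
    pathCost z n = pathCost z' n := by
  refine Finset.sum_congr rfl fun i hi => ?_
  have := Finset.mem_range.1 hi
  rw [h i (by omega), h (i + 1) (by omega)]

lemma mul_le_pathCost {z : ℕ → X} {s : ℝ} {n : ℕ} (h : ∀ i < n, s ≤ dist (z i) (z (i + 1))) :
    n * s ≤ pathCost z n := by
  have := Finset.card_nsmul_le_sum (Finset.range n) (fun i => dist (z i) (z (i + 1))) s
    fun i hi => h i (Finset.mem_range.1 hi)
  simpa [pathCost] using this

lemma cauchySeq_of_pathCost_le {z : ℕ → X} {C : ℝ} (h : ∀ n, pathCost z n ≤ C) :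
    CauchySeq z :=
  cauchySeq_of_summable_dist (summable_of_sum_range_le (fun _ => dist_nonneg) h)

end PathCost

section Instances

variable {d : ℕ}

lemma moveCost_eq_pathCost (I : CBCInstance d) (z : ℕ → Euc d) :
    moveCost I z = pathCost z I.T := by
  unfold moveCost pathCost
  rw [Finset.range_eq_Ico]
  refine (Finset.sum_Ico_add' (fun t => ‖z t - z (t - 1)‖) 0 I.T 1).symm.trans ?_
  exact Finset.sum_congr rfl fun i _ => by simp [dist_eq_norm']

lemma COpt_le_moveCost {I : CBCInstance d} {z : ℕ → Euc d} (h : Feasible I z) :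
    COpt I ≤ moveCost I z :=
  csInf_le ⟨0, by rintro _ ⟨z, -, rfl⟩; exact Finset.sum_nonneg fun _ _ => norm_nonneg _⟩
    ⟨z, h, rfl⟩

lemma COpt_nonneg (I : CBCInstance d) : 0 ≤ COpt I :=
  Real.sInf_nonneg (by rintro _ ⟨z, -, rfl⟩; exact Finset.sum_nonneg fun _ _ => norm_nonneg _)

/-- The instance starting at the origin and serving the first `T` bodies of `K`. -/
def originInstance (K : ℕ → Set (Euc d)) (hK : ∀ t, GoodBody (K t)) (T : ℕ) (hT : 1 ≤ T) :
    CBCInstance d :=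
  ⟨0, T, hT, K, fun t _ => hK t⟩

/-- The sequence which moves from the origin to `p` in the first step and stays there. -/
def jumpTo (p : Euc d) (t : ℕ) : Euc d := if t = 0 then 0 else p

lemma pathCost_jumpTo (p : Euc d) {n : ℕ} (hn : 1 ≤ n) : pathCost (jumpTo p) n = ‖p‖ := by
  induction n, hn using Nat.le_induction with
  | base => simp [pathCost, jumpTo]
  | succ n hn ih => rw [pathCost_succ, ih]; simp [jumpTo, show n ≠ 0 by omega]

lemma COpt_originInstance_le {K : ℕ → Set (Euc d)} {hK : ∀ t, GoodBody (K t)} {T : ℕ}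
    {hT : 1 ≤ T} {p : Euc d} (hp : ∀ t, p ∈ K t) : COpt (originInstance K hK T hT) ≤ ‖p‖ := by
  refine (COpt_le_moveCost (z := jumpTo p) ⟨rfl, fun t ht => ?_⟩).trans_eq ?_
  · have := (Finset.mem_Icc.1 ht).1
    simpa [jumpTo, show t ≠ 0 by omega, originInstance] using hp t
  · rw [moveCost_eq_pathCost]; exact pathCost_jumpTo p hT

/-- The positions of an online algorithm serving the bodies `K` from the origin. -/
def onlinePlay (Rob : Euc d → List (Set (Euc d)) → Euc d) (K : ℕ → Set (Euc d)) (t : ℕ) :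
    Euc d :=
  if t = 0 then 0 else Rob 0 ((List.range t).map fun i => K (i + 1))

/-- The positions of an advice-taking algorithm serving the bodies `K` from the origin. -/
def advicePlay (Alg : Euc d → List (Set (Euc d)) → List (Euc d) → Euc d)
    (K : ℕ → Set (Euc d)) (adv : ℕ → Euc d) (t : ℕ) : Euc d :=
  if t = 0 then 0 else
    Alg 0 ((List.range t).map fun i => K (i + 1)) ((List.range t).map fun i => adv (i + 1))

lemma moveCost_robDecisions (Rob : Euc d → List (Set (Euc d)) → Euc d)
    (K : ℕ → Set (Euc d)) (hK : ∀ t, GoodBody (K t)) (T : ℕ) (hT : 1 ≤ T) :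
    moveCost (originInstance K hK T hT) (robDecisions Rob (originInstance K hK T hT)) =
      pathCost (onlinePlay Rob K) T :=
  moveCost_eq_pathCost _ _

lemma moveCost_algDecisions (Alg : Euc d → List (Set (Euc d)) → List (Euc d) → Euc d)
    (K : ℕ → Set (Euc d)) (hK : ∀ t, GoodBody (K t)) (T : ℕ) (hT : 1 ≤ T) (adv : ℕ → Euc d) :
    moveCost (originInstance K hK T hT) (algDecisions Alg (originInstance K hK T hT) adv) =
      pathCost (advicePlay Alg K adv) T :=
  moveCost_eq_pathCost _ _

lemma map_range_succ_congr {α : Type*} {f g : ℕ → α} {n : ℕ} (h : ∀ t, 1 ≤ t → t ≤ n → f t = g t) :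
    ((List.range n).map fun i => f (i + 1)) = (List.range n).map fun i => g (i + 1) :=
  List.map_congr_left fun i hi => h _ (by omega) (List.mem_range.1 hi)

lemma onlinePlay_congr (Rob : Euc d → List (Set (Euc d)) → Euc d) {K K' : ℕ → Set (Euc d)}
    {n : ℕ} (h : ∀ t, 1 ≤ t → t ≤ n → K t = K' t) : onlinePlay Rob K n = onlinePlay Rob K' n := by
  unfold onlinePlay
  rw [map_range_succ_congr h]

lemma advicePlay_congr (Alg : Euc d → List (Set (Euc d)) → List (Euc d) → Euc d)
    {K K' : ℕ → Set (Euc d)} {adv adv' : ℕ → Euc d} {n : ℕ}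
    (h : ∀ t, 1 ≤ t → t ≤ n → K t = K' t) (h' : ∀ t, 1 ≤ t → t ≤ n → adv t = adv' t) :
    advicePlay Alg K adv n = advicePlay Alg K' adv' n := by
  unfold advicePlay
  rw [map_range_succ_congr h, map_range_succ_congr h']

lemma onlinePlay_mem {Rob : Euc d → List (Set (Euc d)) → Euc d} (hRob : OnlineCBCAlg Rob)
    {K : ℕ → Set (Euc d)} (hK : ∀ t, GoodBody (K t)) {t : ℕ} (ht : 1 ≤ t) :
    onlinePlay Rob K t ∈ K t := by
  obtain ⟨n, rfl⟩ := Nat.exists_eq_add_of_le' ht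
  have h := hRob 0 ((List.range n).map fun i => K (i + 1)) (K (n + 1)) (by
    intro B hB
    simp only [List.mem_append, List.mem_map, List.mem_singleton] at hB
    obtain ⟨i, -, rfl⟩ | rfl := hB <;> exact hK _)
  simpa [onlinePlay, List.range_succ] using h

lemma advicePlay_eq_or {Alg : Euc d → List (Set (Euc d)) → List (Euc d) → Euc d}
    {Rob : Euc d → List (Set (Euc d)) → Euc d} (h : SwitchesBetween Alg Rob)
    (K : ℕ → Set (Euc d)) (adv : ℕ → Euc d) {t : ℕ} (ht : 1 ≤ t) :
    advicePlay Alg K adv t = adv t ∨ advicePlay Alg K adv t = onlinePlay Rob K t := by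
  obtain ⟨n, rfl⟩ := Nat.exists_eq_add_of_le' ht
  have h := h 0 ((List.range (n + 1)).map fun i => K (i + 1))
    ((List.range (n + 1)).map fun i => adv (i + 1)) (by simp)
  simpa [advicePlay, onlinePlay, List.range_succ] using h

lemma cauchySeq_onlinePlay {Rob : Euc d → List (Set (Euc d)) → Euc d} {b : ℝ}
    (hRob : Competitive Rob b) {K : ℕ → Set (Euc d)} (hK : ∀ t, GoodBody (K t))
    {p : Euc d} (hp : ∀ t, p ∈ K t) : CauchySeq (onlinePlay Rob K) := by
  refine cauchySeq_of_pathCost_le (C := |b| * ‖p‖) fun n => ?_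
  have h := hRob (originInstance K hK (n + 1) (by omega))
  rw [moveCost_robDecisions] at h
  calc pathCost (onlinePlay Rob K) n ≤ pathCost (onlinePlay Rob K) (n + 1) := by
        rw [pathCost_succ]; linarith [dist_nonneg (x := onlinePlay Rob K n)
          (y := onlinePlay Rob K (n + 1))]
    _ ≤ b * COpt (originInstance K hK (n + 1) (by omega)) := h
    _ ≤ |b| * ‖p‖ := mul_le_mul (le_abs_self b) (COpt_originInstance_le hp) (COpt_nonneg _)
        (abs_nonneg b)

end Instances

section Walk

variable {d : ℕ}

/-- The advice which jumps from the origin to `p`, waits there until time `M` and then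
makes `j` steps by the vector `e`. -/
def walk (p e : Euc d) (M j t : ℕ) : Euc d :=
  if t = 0 then 0 else p + ((min (t - M) j : ℕ) : ℝ) • e

lemma walk_of_pos (p e : Euc d) (M j : ℕ) {t : ℕ} (ht : 1 ≤ t) :
    walk p e M j t = p + ((min (t - M) j : ℕ) : ℝ) • e := if_neg (by omega)

lemma pathCost_walk (p e : Euc d) {M : ℕ} (hM : 1 ≤ M) (j : ℕ) {n : ℕ} (hn : 1 ≤ n) :
    pathCost (walk p e M j) n = ‖p‖ + (min (n - M) j : ℕ) * ‖e‖ := by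
  induction n, hn using Nat.le_induction with
  | base => simp [pathCost, walk, show 1 - M = 0 by omega]
  | succ n hn ih =>
    have hle : min (n - M) j ≤ min (n + 1 - M) j := by omega
    rw [pathCost_succ, ih, walk_of_pos _ _ _ _ hn, walk_of_pos _ _ _ _ (by omega),
      dist_add_left, dist_eq_norm', ← sub_smul, norm_smul, Real.norm_of_nonneg]
    · ring
    · exact sub_nonneg.2 (by exact_mod_cast hle)

/-- If the advice walks away from a (nearly) resting `Rob`, then a robust switching algorithm
has to return to `Rob`, and forcing it back to the advice afterwards makes it pay about three
times the advice's cost. -/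
lemma exists_instance_of_resting {Rob : Euc d → List (Set (Euc d)) → Euc d}
    (hRob : OnlineCBCAlg Rob) {Alg : Euc d → List (Set (Euc d)) → List (Euc d) → Euc d}
    (hsw : SwitchesBetween Alg Rob) {R : ℝ} (hR : Robust Alg R)
    {K : ℕ → Set (Euc d)} (hK : ∀ t, GoodBody (K t)) {p u : Euc d} {k M : ℕ}
    (hk : 1 ≤ k) (hkM : k ≤ M) (hp : ∀ t, ∀ a : ℝ, p + a • u ∈ K t) (hu : ‖u‖ = 1)
    {r ε η : ℝ} (hr : 0 ≤ r) (hη : 0 < η) (hy : onlinePlay Rob K M = p - r • u)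
    (hrest : ∀ n ≥ M, dist (onlinePlay Rob K n) (onlinePlay Rob K M) ≤ ε)
    (hadv : advicePlay Alg K (jumpTo p) k = p) :
    ∃ (I : CBCInstance d) (adv : ℕ → Euc d) (a : ℝ), 0 ≤ a ∧ Feasible I adv ∧
      moveCost I adv = ‖p‖ + a ∧
      ‖p‖ + 2 * r + 3 * a - 2 * η - 2 * ε ≤ moveCost I (algDecisions Alg I adv) := by
  have hM : 1 ≤ M := hk.trans hkM
  set e : Euc d := η • u with he
  have hen : ‖e‖ = η := by rw [he, norm_smul, hu, Real.norm_of_nonneg hη.le, mul_one]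
  have hpe : ∀ t, ∀ a : ℝ, p + a • e ∈ K t := fun t a => by
    rw [he, smul_smul]; exact hp t _
  have hpK : ∀ t, p ∈ K t := fun t => by simpa using hp t 0
  have hfeas : ∀ (K' : ℕ → Set (Euc d)) (hK' : ∀ t, GoodBody (K' t)) (j T : ℕ) (hT : 1 ≤ T),
      (∀ t, 1 ≤ t → walk p e M j t ∈ K' t) →
      Feasible (originInstance K' hK' T hT) (walk p e M j) := fun K' hK' j T hT h =>
    ⟨rfl, fun t ht => h t (Finset.mem_Icc.1 ht).1⟩
  have hex : ∃ j : ℕ, advicePlay Alg K (walk p e M j) (M + j) ≠ p + (j : ℝ) • e := by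
    by_contra! hall
    obtain ⟨J, hJ⟩ := exists_nat_gt ((|R| * ‖p‖ + ‖p‖) / η)
    rw [div_lt_iff₀ hη] at hJ
    have h := hR _ _ (hfeas K hK J (M + J) (by omega) fun t ht => by
      rw [walk_of_pos _ _ _ _ ht]; exact hpe _ _)
    rw [moveCost_algDecisions] at h
    have h1 := dist_le_pathCost (advicePlay Alg K (walk p e M J)) (M + J)
    rw [hall, show advicePlay Alg K (walk p e M J) 0 = 0 from rfl, dist_zero_left] at h1
    have h2 : R * COpt (originInstance K hK (M + J) (by omega)) ≤ |R| * ‖p‖ :=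
      mul_le_mul (le_abs_self R) (COpt_originInstance_le hpK) (COpt_nonneg _) (abs_nonneg R)
    have h3 : ‖(J : ℝ) • e‖ ≤ ‖p + (J : ℝ) • e‖ + ‖p‖ := by
      simpa using norm_sub_le (p + (J : ℝ) • e) p
    rw [norm_smul, hen, Real.norm_natCast] at h3
    linarith
  obtain ⟨j, hj, hmin⟩ : ∃ j : ℕ, advicePlay Alg K (walk p e M j) (M + j) ≠ p + (j : ℝ) • e ∧
      ∀ i < j, advicePlay Alg K (walk p e M i) (M + i) = p + (i : ℝ) • e :=
    ⟨Nat.find hex, Nat.find_spec hex, fun i hi => not_not.1 (Nat.find_min hex hi)⟩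
  set q : Euc d := p + (j : ℝ) • e with hq
  set K' : ℕ → Set (Euc d) := fun t => if t ≤ M + j then K t else {q} with hK'
  have hK'good : ∀ t, GoodBody (K' t) := fun t => by
    by_cases h : t ≤ M + j
    · simpa [hK', h] using hK t
    · simpa [hK', h] using ⟨Set.singleton_nonempty q, isClosed_singleton, convex_singleton q⟩
  set A := advicePlay Alg K' (walk p e M j) with hA
  have hwalk : ∀ i ≤ j, A (M + i) = advicePlay Alg K (walk p e M i) (M + i) := fun i hi => by
    refine advicePlay_congr Alg (fun t _ ht => if_pos (by omega)) fun t h1 ht => ?_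
    rw [walk_of_pos _ _ _ _ h1, walk_of_pos _ _ _ _ h1, show min (t - M) j = min (t - M) i by omega]
  have hlast : A (M + j + 1) = q := by
    have hmem : onlinePlay Rob K' (M + j + 1) ∈ ({q} : Set (Euc d)) := by
      simpa [hK'] using onlinePlay_mem hRob hK'good (t := M + j + 1) (by omega)
    rcases advicePlay_eq_or hsw K' (walk p e M j) (t := M + j + 1) (by omega) with h | h
    · rw [hA, h, walk_of_pos _ _ _ _ (by omega), show min (M + j + 1 - M) j = j by omega]
    · rw [hA, h]; exact hmem
  have hback : A (M + j) = onlinePlay Rob K (M + j) := by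
    rw [hwalk j le_rfl]
    refine (advicePlay_eq_or hsw K (walk p e M j) (by omega)).resolve_left fun h => hj ?_
    rw [h, walk_of_pos _ _ _ _ (by omega), show min (M + j - M) j = j by omega]
  have hfar : ∀ i : ℕ, r + i * η - ε ≤ dist (p + (i : ℝ) • e) (onlinePlay Rob K (M + j)) := by
    intro i
    have h1 : dist (p + (i : ℝ) • e) (onlinePlay Rob K M) = r + i * η := by
      rw [hy, dist_eq_norm, he, smul_smul,
        show p + ((i : ℝ) * η) • u - (p - r • u) = (r + i * η) • u by rw [add_smul]; abel,
        norm_smul, hu, mul_one, Real.norm_of_nonneg (by positivity)]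
    have h2 := dist_triangle (p + (i : ℝ) • e) (onlinePlay Rob K (M + j)) (onlinePlay Rob K M)
    linarith [hrest (M + j) (by omega)]
  refine ⟨originInstance K' hK'good (M + j + 1) (by omega), walk p e M j, j * η, by positivity,
    hfeas _ _ _ _ _ fun t ht => ?_, ?_, ?_⟩
  · rw [walk_of_pos _ _ _ _ ht]
    by_cases h : t ≤ M + j
    · simpa [hK', h] using hpe t _
    · simp [hK', h, hq, show min (t - M) j = j by omega]
  · rw [moveCost_eq_pathCost]
    change pathCost _ (M + j + 1) = _
    rw [pathCost_walk p e hM j (by omega), hen, show min (M + j + 1 - M) j = j by omega]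
  · rw [moveCost_algDecisions, ← hA]
    have h0 : A 0 = 0 := rfl
    have hstep := pathCost_succ A (M + j)
    rw [hlast, hback, dist_comm] at hstep
    have hfinal := hfar j
    rcases Nat.eq_zero_or_pos j with rfl | hjpos
    · have hAk : A k = p := by
        rw [← hadv]
        refine advicePlay_congr Alg (fun t _ ht => if_pos (by omega)) fun t h1 ht => ?_
        simp [walk, jumpTo]
      have h1 := dist_le_pathCost A k
      have h2 := pathCost_add_dist_le A (show k ≤ M + 0 by omega)
      rw [h0, hAk, dist_zero_left] at h1
      rw [hAk, hback] at h2
      have h3 := hfar 0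
      simp only [hq, Nat.cast_zero, zero_smul, add_zero, zero_mul] at *
      linarith
    · obtain ⟨i, rfl⟩ := Nat.exists_eq_add_of_le' hjpos
      have hAM : A M = p := by
        simpa using (hwalk 0 (by omega)).trans (hmin 0 (by omega))
      have hAi : A (M + i) = p + (i : ℝ) • e := (hwalk i (by omega)).trans (hmin i (by omega))
      have h1 := dist_le_pathCost A M
      have h2 := pathCost_add_dist_le A (show M ≤ M + i by omega)
      have h3 := pathCost_add_dist_le A (show M + i ≤ M + (i + 1) by omega)
      rw [h0, hAM, dist_zero_left] at h1
      rw [hAM, hAi, dist_self_add_right, norm_smul, hen, Real.norm_natCast] at h2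
      rw [hAi, hback] at h3
      have h4 := hfar i
      rw [← hq] at hfinal
      push_cast at hfinal ⊢
      linarith

end Walk

section Flats

variable {d : ℕ}

/-- The affine subspace of points whose first `k` coordinates are prescribed by `σ`. -/
def coordFlat (d : ℕ) (σ : ℕ → ℝ) (k : ℕ) : Set (Euc d) :=
  {x | ∀ i : Fin d, (i : ℕ) < k → x i = σ i}

lemma goodBody_coordFlat (σ : ℕ → ℝ) (k : ℕ) : GoodBody (coordFlat d σ k) := by
  refine ⟨⟨WithLp.toLp 2 fun i => σ i, fun i _ => rfl⟩, ?_, ?_⟩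
  · simp only [coordFlat, Set.ofPred_forall]
    exact isClosed_iInter fun i => isClosed_iInter fun _ =>
      isClosed_eq (by fun_prop) continuous_const
  · intro x hx y hy a b _ _ hab i hi
    simp [hx i hi, hy i hi, ← add_mul, hab]

/-- The bodies which reveal the coordinates of `σ` one at a time, stopping after `k` of them. -/
def flats (d : ℕ) (σ : ℕ → ℝ) (k t : ℕ) : Set (Euc d) := coordFlat d σ (min t k)

lemma coordFlat_congr {σ σ' : ℕ → ℝ} {k : ℕ} (h : ∀ i < k, σ i = σ' i) :
    coordFlat d σ k = coordFlat d σ' k := by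
  ext x
  exact forall₂_congr fun i hi => by rw [h i hi]

/-- There are signs for the coordinates such that each one, when revealed, is opposite to the
current position of `Rob`. -/
lemma exists_adversarial_signs (Rob : Euc d → List (Set (Euc d)) → Euc d) {s : ℝ} (hs : 0 ≤ s)
    (K n : ℕ) (hn : n ≤ K) :
    ∃ σ : ℕ → ℝ, (∀ j, |σ j| = s) ∧ ∀ j : Fin d, (j : ℕ) < n →
      s ≤ |σ j - onlinePlay Rob (flats d σ K) j j| := by
  induction n with
  | zero => exact ⟨fun _ => s, fun _ => abs_of_nonneg hs, fun j hj => by omega⟩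
  | succ n ih =>
    obtain ⟨σ, hσ, h⟩ := ih (by omega)
    have hsign : ∀ x : ℝ, ∃ v : ℝ, |v| = s ∧ s ≤ |v - x| := fun x => by
      rcases le_total 0 x with hx | hx
      · exact ⟨-s, by rw [abs_neg, abs_of_nonneg hs],
          le_abs.2 (Or.inr (by linarith))⟩
      · exact ⟨s, abs_of_nonneg hs, le_abs.2 (Or.inl (by linarith))⟩
    by_cases hnd : n < d
    · obtain ⟨v, hv, hv'⟩ := hsign (onlinePlay Rob (flats d σ K) n ⟨n, hnd⟩)
      have hcongr : ∀ m ≤ n, onlinePlay Rob (flats d (Function.update σ n v) K) m =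
          onlinePlay Rob (flats d σ K) m := fun m hm =>
        onlinePlay_congr Rob fun t _ ht => coordFlat_congr fun i hi =>
          Function.update_of_ne (by omega) _ _
      refine ⟨Function.update σ n v, fun j => ?_, fun j hj => ?_⟩
      · rcases eq_or_ne j n with rfl | hj <;> simp [*]
      · rw [hcongr j (by omega)]
        rcases Nat.lt_succ_iff_lt_or_eq.1 hj with hj' | hj'
        · rw [Function.update_of_ne (by omega)]; exact h j hj'
        · obtain rfl : j = ⟨n, hnd⟩ := Fin.ext hj'
          simpa using hv'
    · exact ⟨σ, hσ, fun j _ => h j (by omega)⟩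

end Flats

lemma exists_unit_orthogonal {E : Type*} [NormedAddCommGroup E] [InnerProductSpace ℝ E]
    [FiniteDimensional ℝ E] {ι : Type*} [Fintype ι] (f : ι → E)
    (h : Fintype.card ι < Module.finrank ℝ E) :
    ∃ w : E, ‖w‖ = 1 ∧ ∀ i, inner ℝ (f i) w = 0 := by
  have hne : (Submodule.span ℝ (Set.range f))ᗮ ≠ ⊥ := fun hbot => by
    have h1 := Submodule.finrank_add_finrank_orthogonal (Submodule.span ℝ (Set.range f))
    have h2 : Module.finrank ℝ (Submodule.span ℝ (Set.range f)) ≤ Fintype.card ι :=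
      finrank_range_le_card f
    rw [hbot, finrank_bot] at h1
    omega
  obtain ⟨x, hx, hx0⟩ := Submodule.exists_mem_ne_zero_of_ne_bot hne
  refine ⟨‖x‖⁻¹ • x, by simp [norm_smul, hx0], fun i => ?_⟩
  rw [inner_smul_right, (Submodule.mem_orthogonal _ _).1 hx _
    (Submodule.subset_span (Set.mem_range_self i)), mul_zero]

/-- **Lower bound for switching algorithms.** For every `c < 3` there
is a dimension `d` (a perfect square) such that, in Euclidean `ℝ^d`: for every `b`,
every advice-agnostic `b`-competitive deterministic online CBC algorithm `Rob`, and
every algorithm `Alg` switching between advice and `Rob`, if `Alg` is `c`-consistent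
then `Alg` is not `R`-robust for any real `R`. -/
theorem switching_lower_bound :
    ∀ c : ℝ, c < 3 →
      ∃ d : ℕ, 0 < d ∧ (∃ m : ℕ, d = m * m) ∧
        ∀ (b : ℝ) (Rob : Euc d → List (Set (Euc d)) → Euc d),
          OnlineCBCAlg Rob → Competitive Rob b →
          ∀ Alg : Euc d → List (Set (Euc d)) → List (Euc d) → Euc d,
            SwitchesBetween Alg Rob → Consistent Alg c →
            ¬ ∃ R : ℝ, Robust Alg R := by
  intro c hc
  obtain ⟨K, hK⟩ := exists_nat_gt (max 24 (48 / (3 - c)))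
  have hδ : 0 < 3 - c := by linarith
  have hK24 : (24 : ℝ) < K := (le_max_left _ _).trans_lt hK
  have hKδ : 48 < K * (3 - c) := (div_lt_iff₀ hδ).1 ((le_max_right _ _).trans_lt hK)
  have hK1 : 1 ≤ K := by
    have : 24 < K := by exact_mod_cast hK24
    omega
  have hK0 : (0 : ℝ) < K := by linarith
  have hd : 2 * K < (2 * K + 1) * (2 * K + 1) := by nlinarith
  refine ⟨(2 * K + 1) * (2 * K + 1), by positivity, ⟨_, rfl⟩, ?_⟩
  generalize (2 * K + 1) * (2 * K + 1) = d at hd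
  rintro b Rob hRob hcomp Alg hsw hcons ⟨R, hR⟩
  have hs : (0 : ℝ) ≤ 4 / K := by positivity
  obtain ⟨σ, hσ, hsign⟩ := exists_adversarial_signs (d := d) Rob hs K K le_rfl
  have hgood : ∀ k t, GoodBody (flats d σ k t) := fun k t => goodBody_coordFlat _ _
  set ε : ℝ := (3 - c) / 8 with hε
  have hε0 : 0 < ε := by positivity
  have hrest : ∀ k, ∃ M, k ≤ M ∧ ∀ n ≥ M, dist (onlinePlay Rob (flats d σ k) n)
      (onlinePlay Rob (flats d σ k) M) ≤ ε := fun k => by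
    obtain ⟨N, hN⟩ := Metric.cauchySeq_iff.1 (cauchySeq_onlinePlay hcomp (hgood k)
      (p := WithLp.toLp 2 fun i => σ i) fun t i _ => rfl) ε hε0
    exact ⟨max N k, le_max_right _ _, fun n hn =>
      (hN n ((le_max_left _ _).trans hn) _ (le_max_left _ _)).le⟩
  choose M hM hrest using hrest
  obtain ⟨w, hw, hort⟩ := exists_unit_orthogonal (E := Euc d) (ι := Fin K ⊕ Fin K)
    (Sum.elim (fun j => EuclideanSpace.single ⟨j, by omega⟩ 1)
      fun j => onlinePlay Rob (flats d σ (j + 1)) (M (j + 1))) (by simp; omega)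
  have hwlt : ∀ i : Fin d, (i : ℕ) < K → w i = 0 := fun i hi => by
    have h := hort (Sum.inl ⟨i, hi⟩)
    rw [Sum.elim_inl, EuclideanSpace.inner_single_left] at h
    simpa using h
  have hworth : ∀ k, 1 ≤ k → k ≤ K →
      inner ℝ (onlinePlay Rob (flats d σ k) (M k)) w = 0 := fun k h1 hk => by
    obtain ⟨j, rfl⟩ := Nat.exists_eq_add_of_le' h1
    exact hort (Sum.inr ⟨j, hk⟩)
  set v : Euc d := WithLp.toLp 2 fun i => if (i : ℕ) < K then σ i else 0 with hv
  have hvw : inner ℝ v w = 0 := by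
    rw [PiLp.inner_apply]
    refine Finset.sum_eq_zero fun i _ => ?_
    by_cases hi : (i : ℕ) < K
    · simp [hwlt i hi]
    · simp [hv, hi]
  have hvnorm : ‖v‖ ^ 2 ≤ 16 / K := by
    have hterm : ∀ i : Fin d, ‖v i‖ ^ 2 = if (i : ℕ) < K then (4 / K : ℝ) ^ 2 else 0 := fun i => by
      by_cases hi : (i : ℕ) < K <;> simp [hv, hi, ← hσ i]
    rw [EuclideanSpace.norm_sq_eq, Finset.sum_congr rfl fun i _ => hterm i,
      Fin.sum_univ_eq_sum_range (fun i => if i < K then (4 / K : ℝ) ^ 2 else 0),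
      ← Finset.sum_filter, Finset.sum_const, nsmul_eq_mul]
    have hcard : (Finset.filter (· < K) (Finset.range d)).card ≤ K := by
      refine (Finset.card_le_card fun i hi => ?_).trans_eq (Finset.card_range K)
      exact Finset.mem_range.2 (Finset.mem_filter.1 hi).2
    calc _ ≤ (K : ℝ) * (4 / K) ^ 2 := by gcongr
      _ = 16 / K := by field_simp; norm_num
  set p : Euc d := v + w with hp
  have hpsq : ‖p‖ ^ 2 = ‖v‖ ^ 2 + 1 := by rw [hp, norm_add_sq_real, hvw, hw]; ring
  have hp1 : 1 ≤ ‖p‖ := by nlinarith [norm_nonneg p, sq_nonneg ‖v‖]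
  have hp2 : ‖p‖ ≤ 1 + 8 / K := by
    refine abs_le_of_sq_le_sq' (b := 1 + 8 / (K : ℝ)) ?_ (by positivity) |>.2
    have : (16 : ℝ) / K = 2 * (8 / K) := by ring
    nlinarith [sq_nonneg (8 / (K : ℝ))]
  have hKinv : 8 / (K : ℝ) < (3 - c) / 6 := by
    rw [div_lt_div_iff₀ hK0 (by norm_num)]; linarith
  have hKinv' : 8 / (K : ℝ) < 1 / 3 := by
    rw [div_lt_div_iff₀ hK0 (by norm_num)]; linarith
  have hpflat : ∀ k ≤ K, ∀ t, p ∈ flats d σ k t := fun k hk t i hi => by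
    have : (i : ℕ) < K := by omega
    simp [hp, hv, this, hwlt i this]
  by_cases hstay : ∀ t, 1 ≤ t → t ≤ K → advicePlay Alg (flats d σ K) (jumpTo p) t ≠ p
  · have heq : ∀ t ≤ K, advicePlay Alg (flats d σ K) (jumpTo p) t =
        onlinePlay Rob (flats d σ K) t := fun t ht => by
      rcases Nat.eq_zero_or_pos t with rfl | h
      · rfl
      · refine (advicePlay_eq_or hsw _ _ h).resolve_left fun h' => hstay t h ht ?_
        rw [h', jumpTo, if_neg (by omega)]
    have h := hcons (originInstance _ (hgood K) K hK1) (jumpTo p)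
      ⟨rfl, fun t ht => by
        have := (Finset.mem_Icc.1 ht).1
        simpa [jumpTo, show t ≠ 0 by omega, originInstance] using hpflat K le_rfl t⟩
    rw [moveCost_algDecisions, moveCost_eq_pathCost, pathCost_congr heq] at h
    change _ ≤ c * pathCost (jumpTo p) K at h
    rw [pathCost_jumpTo p hK1] at h
    have hcost : (K : ℝ) * (4 / K) ≤ pathCost (onlinePlay Rob (flats d σ K)) K :=
      mul_le_pathCost fun i hi => by
        have hid : i < d := by omega
        have hmem : onlinePlay Rob (flats d σ K) (i + 1) ⟨i, hid⟩ = σ i :=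
          onlinePlay_mem hRob (hgood K) (t := i + 1) (by omega) ⟨i, hid⟩ (by simp; omega)
        rw [dist_eq_norm']
        refine (hsign ⟨i, hid⟩ hi).trans ?_
        simpa [hmem] using PiLp.norm_apply_le
          (onlinePlay Rob (flats d σ K) (i + 1) - onlinePlay Rob (flats d σ K) i) ⟨i, hid⟩
    rw [mul_div_cancel₀ _ hK0.ne'] at hcost
    nlinarith
  · push Not at hstay
    obtain ⟨k, hk1, hkK, hk⟩ := hstay
    have hk' : advicePlay Alg (flats d σ k) (jumpTo p) k = p := by
      refine (advicePlay_congr Alg (fun t _ ht => ?_) fun _ _ _ => rfl).trans hk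
      rw [flats, flats, min_eq_left ht, min_eq_left (ht.trans hkK)]
    set y := onlinePlay Rob (flats d σ k) (M k)
    have hr : 1 ≤ ‖p - y‖ := by
      have h := real_inner_le_norm (p - y) w
      rw [inner_sub_left, hworth k hk1 hkK, hp, inner_add_left, hvw, real_inner_self_eq_norm_sq,
        hw] at h
      linarith
    have hr0 : ‖p - y‖ ≠ 0 := by linarith
    have hyflat : y ∈ coordFlat d σ k := by
      have := onlinePlay_mem hRob (hgood k) (t := M k) (hk1.trans (hM k))
      rwa [flats, min_eq_right (hM k)] at this
    obtain ⟨I, adv, a, ha, hfeas, hadv, hcost⟩ := exists_instance_of_resting hRob hsw hR (hgood k)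
      (p := p) (u := ‖p - y‖⁻¹ • (p - y)) hk1 (hM k)
      (fun t a i hi => by
        have h1 : p i = σ i := hpflat k hkK t i hi
        have h2 : y i = σ i := hyflat i (by omega)
        simp [h1, h2])
      (by rw [norm_smul, norm_inv, norm_norm, inv_mul_cancel₀ hr0])
      (norm_nonneg (p - y)) hε0 (by rw [smul_inv_smul₀ hr0, sub_sub_cancel]) (hrest k) hk'
    have h := hcons I adv hfeas
    rw [hadv] at h
    nlinarith

end
end

section
/- (Consistency of NestedSwitch.) In ℝ^d with the Euclidean norm, let T be a positive integer, r > 0, y ∈ ℝ^d, and let K_T ⊆ K_{T−1} ⊆ … ⊆ K_1 be nonempty convex subsets with K_1 contained in the closed ball B(y, r) and x_0 ∈ B(y, r). Let ã_0 = s_0 = x_0 and let ã_t ∈ K_t and s_t ∈ K_t for all 1 ≤ t ≤ T, with ‖s_1 − y‖ + Σ_{t=2}^T ‖s_t − s_{t−1}‖ ≤ r·d. Let ε > 0 and define the NestedSwitch sequence x_1, …, x_T by: x_t = s_t if ε·Σ_{i=1}^t ‖ã_i − ã_{i−1}‖ ≥ r·(d + 2), and x_t = ã_t otherwise. Then Σ_{t=1}^T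 ‖x_t − x_{t−1}‖ ≤ (1 + ε)·Σ_{t=1}^T ‖ã_t − ã_{t−1}‖ (with x_0 = ã_0 = x_0). -/
open scoped Classical

/-- A point of a path is at distance from `y` at most that of the first point plus the length of
the path up to it. -/
theorem norm_sub_le_norm_sub_add_sum {E : Type*} [SeminormedAddCommGroup E] (s : ℕ → E) (y : E)
    {n : ℕ} (hn : 1 ≤ n) :
    ‖s n - y‖ ≤ ‖s 1 - y‖ + ∑ t ∈ Finset.Icc 2 n, ‖s t - s (t - 1)‖ := by
  induction n, hn using Nat.le_induction with
  | base => simp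
  | succ n hn ih =>
    rw [Finset.sum_Icc_succ_top (by omega), Nat.add_sub_cancel]
    linarith [norm_sub_le_norm_sub_add_norm_sub (s (n + 1)) (s n) y]

/-- Let `x` follow `a` until the monotone condition `P` holds and follow `s` from then on. If `a`
stays within distance `r` of `y`, then `x` moves no more than `a` while it follows `a`, and
afterwards by at most `r` plus the length of the path from `y` along `s` more than `a`. -/
theorem switch_invariant {E : Type*} [SeminormedAddCommGroup E] (a s x : ℕ → E) (y : E) (r : ℝ)
    (P : ℕ → Prop) (T : ℕ) (hP : ∀ n, P n → P (n + 1)) (hx0 : x 0 = a 0)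
    (hball : ∀ n ≤ T, ‖a n - y‖ ≤ r)
    (hxs : ∀ n ∈ Finset.Icc 1 T, P n → x n = s n)
    (hxa : ∀ n ∈ Finset.Icc 1 T, ¬ P n → x n = a n) {n : ℕ} (hn : n ≤ T) :
    (x n = a n ∧ ∑ t ∈ Finset.Icc 1 n, ‖x t - x (t - 1)‖ ≤
        ∑ t ∈ Finset.Icc 1 n, ‖a t - a (t - 1)‖) ∨
      (1 ≤ n ∧ P n ∧ x n = s n ∧ ∑ t ∈ Finset.Icc 1 n, ‖x t - x (t - 1)‖ ≤
        ∑ t ∈ Finset.Icc 1 n, ‖a t - a (t - 1)‖ +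
          (r + (‖s 1 - y‖ + ∑ t ∈ Finset.Icc 2 n, ‖s t - s (t - 1)‖))) := by
  induction n with
  | zero => exact Or.inl ⟨hx0, by simp⟩
  | succ n ih =>
    have hmem : n + 1 ∈ Finset.Icc 1 T := Finset.mem_Icc.2 ⟨by omega, hn⟩
    have hs := norm_sub_le_norm_sub_add_sum s y (Nat.le_add_left 1 n)
    have ha := norm_nonneg (a (n + 1) - a n)
    rw [Finset.sum_Icc_succ_top (by omega), Finset.sum_Icc_succ_top (by omega),
      Nat.add_sub_cancel]
    by_cases hPn : P (n + 1)
    · refine Or.inr ⟨by omega, hPn, hxs _ hmem hPn, ?_⟩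
      rw [hxs _ hmem hPn]
      rcases ih (by omega) with ⟨hxn, hle⟩ | ⟨h1, -, hxn, hle⟩
      · have htri := norm_sub_le_norm_sub_add_norm_sub (s (n + 1)) y (a n)
        rw [norm_sub_rev y] at htri
        rw [hxn]
        linarith [hball n (by omega)]
      · rw [hxn, Finset.sum_Icc_succ_top (by omega : 2 ≤ n + 1), Nat.add_sub_cancel]
        linarith
    · refine Or.inl ⟨hxa _ hmem hPn, ?_⟩
      rcases ih (by omega) with ⟨hxn, hle⟩ | ⟨-, hP', -, -⟩
      · rw [hxa _ hmem hPn, hxn]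
        linarith
      · exact absurd (hP n hP') hPn

/-- **Consistency of NestedSwitch.** In Euclidean `ℝ^d`, for nested
convex bodies `K_T ⊆ … ⊆ K_1 ⊆ B(y, r)` with `x₀ ∈ B(y, r)`, an advice `a` and a
Steiner-point robust sequence `s` (satisfying `‖s_1 − y‖ + Σ_{t=2}^T ‖s_t − s_{t−1}‖
≤ r·d`), the NestedSwitch sequence `x` satisfies
`Σ_{t=1}^T ‖x_t − x_{t−1}‖ ≤ (1 + ε)·Σ_{t=1}^T ‖a_t − a_{t−1}‖`. -/
theorem nestedswitch_consistency
    (d : ℕ) (hd : 0 < d) (T : ℕ) (hT : 1 ≤ T) (r : ℝ) (hr : 0 < r)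
    (y x₀ : EuclideanSpace ℝ (Fin d))
    (K : ℕ → Set (EuclideanSpace ℝ (Fin d)))
    (hKne : ∀ t ∈ Finset.Icc 1 T, (K t).Nonempty)
    (hKconv : ∀ t ∈ Finset.Icc 1 T, Convex ℝ (K t))
    (hnested : ∀ t ∈ Finset.Icc 1 (T - 1), K (t + 1) ⊆ K t)
    (hK1 : K 1 ⊆ Metric.closedBall y r) (hx₀ : x₀ ∈ Metric.closedBall y r)
    (a s : ℕ → EuclideanSpace ℝ (Fin d))
    (ha0 : a 0 = x₀) (hs0 : s 0 = x₀)
    (haK : ∀ t ∈ Finset.Icc 1 T, a t ∈ K t)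
    (hsK : ∀ t ∈ Finset.Icc 1 T, s t ∈ K t)
    (hsteiner : ‖s 1 - y‖ + ∑ t ∈ Finset.Icc 2 T, ‖s t - s (t - 1)‖ ≤ r * d)
    (ε : ℝ) (hε : 0 < ε)
    (x : ℕ → EuclideanSpace ℝ (Fin d)) (hx0 : x 0 = x₀)
    (hstep : ∀ t ∈ Finset.Icc 1 T,
      x t =
        if r * ((d : ℝ) + 2) ≤ ε * ∑ i ∈ Finset.Icc 1 t, ‖a i - a (i - 1)‖ then s t
        else a t) :
    ∑ t ∈ Finset.Icc 1 T, ‖x t - x (t - 1)‖ ≤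
      (1 + ε) * ∑ t ∈ Finset.Icc 1 T, ‖a t - a (t - 1)‖ := by
  have hK : ∀ t, 1 ≤ t → t ≤ T → K t ⊆ K 1 := fun t ht => by
    induction t, ht using Nat.le_induction with
    | base => exact fun _ => subset_rfl
    | succ n hn ih =>
      exact fun h =>
        (hnested n (Finset.mem_Icc.2 ⟨hn, by omega⟩)).trans (ih (by omega))
  have hball : ∀ n ≤ T, ‖a n - y‖ ≤ r := fun n hn => by
    rw [← mem_closedBall_iff_norm]
    rcases Nat.eq_zero_or_pos n with rfl | h
    · rwa [ha0]
    · exact hK1 (hK n h hn (haK n (Finset.mem_Icc.2 ⟨h, hn⟩)))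
  have hmono : ∀ n, r * ((d : ℝ) + 2) ≤ ε * ∑ i ∈ Finset.Icc 1 n, ‖a i - a (i - 1)‖ →
      r * ((d : ℝ) + 2) ≤ ε * ∑ i ∈ Finset.Icc 1 (n + 1), ‖a i - a (i - 1)‖ := fun n h => by
    refine h.trans (mul_le_mul_of_nonneg_left ?_ hε.le)
    rw [Finset.sum_Icc_succ_top (by omega)]
    exact le_add_of_nonneg_right (norm_nonneg _)
  rcases switch_invariant a s x y r _ T hmono (hx0.trans ha0.symm) hball
      (fun n hn h => (hstep n hn).trans (if_pos h))
      (fun n hn h => (hstep n hn).trans (if_neg h)) le_rfl with ⟨-, hle⟩ | ⟨-, hthr, -, hle⟩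
  · have hA : 0 ≤ ∑ t ∈ Finset.Icc 1 T, ‖a t - a (t - 1)‖ :=
      Finset.sum_nonneg fun _ _ => norm_nonneg _
    linarith [mul_nonneg hε.le hA]
  · linarith
end

section
/- (Robustness of NestedSwitch.) In ℝ^d with the Euclidean norm, let T be a positive integer, r > 0, y ∈ ℝ^d, and let K_T ⊆ K_{T−1} ⊆ … ⊆ K_1 be nonempty convex subsets with K_1 contained in the closed ball B(y, r) and x_0 ∈ B(y, r). Let ã_0 = s_0 = x_0 and let ã_t ∈ K_t and s_t ∈ K_t for all 1 ≤ t ≤ T, with ‖s_1 − y‖ + Σ_{t=2}^T ‖s_t − s_{t−1}‖ ≤ r·d. Let ε > 0 and define the NestedSwitch sequence x_1, …, x_T by: x_t = s_t if ε·Σ_{i=1}^t ‖ã_i − ã_{i−1}‖ ≥ r·(d + 2), and x_t = ã_t otherwise. Then Σ_{t=1}^T ‖x_t − x_{t−1}‖ ≤ (1 + 1/ε)·r·(d + 2) (with x_0 = ã_0 = x_0). In particular, if the offline optimal cost C_Opt (the infimum of the movement cost over all feasible sequences z_t ∈ K_t starting at x_0) is at least 1, the NestedSwitch cost is at most (1 +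 1/ε)·r·(d + 2)·C_Opt. -/
open scoped Classical

/-- A family that decreases on `{1, …, T}` stays inside its first member. -/
lemma subset_first_of_nested {α : Type*} {T : ℕ} {K : ℕ → Set α}
    (hnested : ∀ t ∈ Finset.Icc 1 (T - 1), K (t + 1) ⊆ K t) {t : ℕ}
    (ht : t ∈ Finset.Icc 1 T) : K t ⊆ K 1 := by
  obtain ⟨h1, hT⟩ := Finset.mem_Icc.mp ht
  induction t, h1 using Nat.le_induction with
  | base => exact subset_rfl
  | succ n hn ih =>
    exact (hnested n (by simp; omega)).trans (ih (by simp; omega) (by omega))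

/-- Follow `a` while `ε` times its movement cost is below the threshold `D`, and `s` afterwards.
If switching from `a` to `s` costs at most `R`, then the movement cost is less than `D / ε` before
the switch, and afterwards it is at most `D / ε + R` plus the movement cost of `s` from time `1`
on. -/
lemma switch_cost_invariant {E : Type*} [SeminormedAddCommGroup E] {T : ℕ} {a s x : ℕ → E}
    {D R ε : ℝ} (hD : 0 < D) (hε : 0 < ε) (hx0 : x 0 = a 0)
    (hR : ∀ t < T, ‖s (t + 1) - a t‖ ≤ R)
    (hstep : ∀ t ∈ Finset.Icc 1 T,
      x t = if D ≤ ε * ∑ i ∈ Finset.Icc 1 t, ‖a i - a (i - 1)‖ then s t else a t)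
    (n : ℕ) (hn : n ≤ T) :
    (ε * ∑ i ∈ Finset.Icc 1 n, ‖a i - a (i - 1)‖ < D ∧ x n = a n ∧
        ∑ t ∈ Finset.Icc 1 n, ‖x t - x (t - 1)‖ = ∑ t ∈ Finset.Icc 1 n, ‖a t - a (t - 1)‖) ∨
      (1 ≤ n ∧ D ≤ ε * ∑ i ∈ Finset.Icc 1 n, ‖a i - a (i - 1)‖ ∧ x n = s n ∧
        ∑ t ∈ Finset.Icc 1 n, ‖x t - x (t - 1)‖ ≤
          D / ε + R + ∑ t ∈ Finset.Icc 2 n, ‖s t - s (t - 1)‖) := by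
  induction n with
  | zero => left; simpa using ⟨hD, hx0⟩
  | succ n ih =>
    have hx := hstep (n + 1) (by simp; omega)
    have hsum (f : ℕ → ℝ) :
        ∑ t ∈ Finset.Icc 1 (n + 1), f t = ∑ t ∈ Finset.Icc 1 n, f t + f (n + 1) :=
      Finset.sum_Icc_succ_top (by omega) f
    rcases ih (by omega) with ⟨hlt, hxn, hcost⟩ | ⟨h1, hle, hxn, hcost⟩
    · split_ifs at hx with h
      · refine Or.inr ⟨by omega, h, hx, ?_⟩
        have hA : ∑ i ∈ Finset.Icc 1 n, ‖a i - a (i - 1)‖ ≤ D / ε := by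
          rw [le_div_iff₀' hε]; exact hlt.le
        have hS : 0 ≤ ∑ t ∈ Finset.Icc 2 (n + 1), ‖s t - s (t - 1)‖ := by positivity
        rw [hsum, hcost, hx, Nat.add_sub_cancel, hxn]
        linarith [hR n (by omega)]
      · refine Or.inl ⟨not_le.mp h, hx, ?_⟩
        rw [hsum, hsum, hcost, hx, Nat.add_sub_cancel, hxn]
    · have h : D ≤ ε * ∑ i ∈ Finset.Icc 1 (n + 1), ‖a i - a (i - 1)‖ := by
        rw [hsum, mul_add]
        exact le_add_of_le_of_nonneg hle (by positivity)
      rw [if_pos h] at hx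
      refine Or.inr ⟨by omega, h, hx, ?_⟩
      rw [hsum, Finset.sum_Icc_succ_top (a := 2) (by omega), hx, Nat.add_sub_cancel, hxn]
      linarith

/-- **Robustness of NestedSwitch.** In Euclidean `ℝ^d`, for nested
convex bodies `K_T ⊆ … ⊆ K_1 ⊆ B(y, r)` with `x₀ ∈ B(y, r)`, an advice `a` and a
Steiner-point robust sequence `s` (satisfying `‖s_1 − y‖ + Σ_{t=2}^T ‖s_t − s_{t−1}‖
≤ r·d`), the NestedSwitch sequence `x` satisfies
`Σ_{t=1}^T ‖x_t − x_{t−1}‖ ≤ (1 + 1/ε)·r·(d + 2)`; in particular, if the offline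
optimal cost `C_Opt ≥ 1`, then the NestedSwitch cost is at most
`(1 + 1/ε)·r·(d + 2)·C_Opt`. -/
theorem nestedswitch_robustness
    (d : ℕ) (hd : 0 < d) (T : ℕ) (hT : 1 ≤ T) (r : ℝ) (hr : 0 < r)
    (y x₀ : EuclideanSpace ℝ (Fin d))
    (K : ℕ → Set (EuclideanSpace ℝ (Fin d)))
    (hKne : ∀ t ∈ Finset.Icc 1 T, (K t).Nonempty)
    (hKconv : ∀ t ∈ Finset.Icc 1 T, Convex ℝ (K t))
    (hnested : ∀ t ∈ Finset.Icc 1 (T - 1), K (t + 1) ⊆ K t)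
    (hK1 : K 1 ⊆ Metric.closedBall y r) (hx₀ : x₀ ∈ Metric.closedBall y r)
    (a s : ℕ → EuclideanSpace ℝ (Fin d))
    (ha0 : a 0 = x₀) (hs0 : s 0 = x₀)
    (haK : ∀ t ∈ Finset.Icc 1 T, a t ∈ K t)
    (hsK : ∀ t ∈ Finset.Icc 1 T, s t ∈ K t)
    (hsteiner : ‖s 1 - y‖ + ∑ t ∈ Finset.Icc 2 T, ‖s t - s (t - 1)‖ ≤ r * d)
    (ε : ℝ) (hε : 0 < ε)
    (x : ℕ → EuclideanSpace ℝ (Fin d)) (hx0 : x 0 = x₀)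
    (hstep : ∀ t ∈ Finset.Icc 1 T,
      x t =
        if r * ((d : ℝ) + 2) ≤ ε * ∑ i ∈ Finset.Icc 1 t, ‖a i - a (i - 1)‖ then s t
        else a t) :
    ∑ t ∈ Finset.Icc 1 T, ‖x t - x (t - 1)‖ ≤ (1 + 1 / ε) * (r * ((d : ℝ) + 2)) ∧
      (1 ≤ sInf {c : ℝ | ∃ z : ℕ → EuclideanSpace ℝ (Fin d), z 0 = x₀ ∧
          (∀ t ∈ Finset.Icc 1 T, z t ∈ K t) ∧
          c = ∑ t ∈ Finset.Icc 1 T, ‖z t - z (t - 1)‖} →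
        ∑ t ∈ Finset.Icc 1 T, ‖x t - x (t - 1)‖ ≤
          (1 + 1 / ε) * (r * ((d : ℝ) + 2)) *
            sInf {c : ℝ | ∃ z : ℕ → EuclideanSpace ℝ (Fin d), z 0 = x₀ ∧
              (∀ t ∈ Finset.Icc 1 T, z t ∈ K t) ∧
              c = ∑ t ∈ Finset.Icc 1 T, ‖z t - z (t - 1)‖}) := by
  have hball {t : ℕ} (ht : t ∈ Finset.Icc 1 T) : K t ⊆ Metric.closedBall y r :=
    (subset_first_of_nested hnested ht).trans hK1
  have ha (t : ℕ) (ht : t ≤ T) : a t ∈ Metric.closedBall y r := by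
    rcases Nat.eq_zero_or_pos t with rfl | h
    · rwa [ha0]
    · have ht' := Finset.mem_Icc.mpr ⟨h, ht⟩
      exact hball ht' (haK t ht')
  have hR (t : ℕ) (ht : t < T) : ‖s (t + 1) - a t‖ ≤ 2 * r := by
    have ht' : t + 1 ∈ Finset.Icc 1 T := by simp; omega
    have hs := hball ht' (hsK _ ht')
    have hat := ha t ht.le
    rw [Metric.mem_closedBall] at hs hat
    rw [← dist_eq_norm]
    linarith [dist_triangle_right (s (t + 1)) (a t) y]
  have hD : 0 < r * ((d : ℝ) + 2) := by positivity
  have hcost : ∑ t ∈ Finset.Icc 1 T, ‖x t - x (t - 1)‖ ≤ (1 + 1 / ε) * (r * ((d : ℝ) + 2)) := by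
    have hsplit : (1 + 1 / ε) * (r * ((d : ℝ) + 2)) =
        r * ((d : ℝ) + 2) / ε + r * ((d : ℝ) + 2) := by ring
    rw [hsplit]
    rcases switch_cost_invariant hD hε (hx0.trans ha0.symm) hR hstep T le_rfl with
      ⟨hlt, -, h⟩ | ⟨-, -, -, h⟩
    · rw [h]
      have := (lt_div_iff₀' hε).mpr hlt
      linarith
    · linarith [norm_nonneg (s 1 - y)]
  exact ⟨hcost, fun hOpt => hcost.trans (le_mul_of_one_le_right (by positivity) hOpt)⟩
end

section
/- (Per-step consistency inequality for Interp.) Let X be a real normed vector space, μ ≥ 1 a real number that is simultaneously a rectangular bound for X and a radial Lipschitz bound for X, γ ≥ 0, and f : X → ℝ a convex function with f ≥ 0 everywhere. Let s′, s, x̃′, x̃ ∈ X and let x′ lie on the segment [s′, x̃′] (i.e., x′ = λ·x̃′ + (1 − λ)·s′ for some λ ∈ [0, 1]). Set Δ = f(x̃) + ‖x̃ − x̃′‖ and define y = s′ + ρ(x̃ − s′; ‖x′ − s′‖), z = s′ + ρ(y − s′; max(‖y − s′‖ − γ·Δ, 0)), and x = s + ρ(x̃ − s; ‖z − s′‖).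 Then f(x) + ‖x − x′‖ + ‖x̃ − x‖ ≤ 2·(f(s) + ‖s − s′‖) + (μ + 2γ)·Δ + ‖x̃′ − x′‖. -/
section RadialRetraction

variable {X : Type*} [NormedAddCommGroup X] [NormedSpace ℝ X]

theorem exists_radial_eq_smul_s14 (v : X) {r : ℝ} (hr : 0 ≤ r) :
    ∃ t : ℝ, 0 ≤ t ∧ t ≤ 1 ∧ radial v r = t • v ∧ t * ‖v‖ = min ‖v‖ r := by
  unfold radial
  split_ifs with h
  · exact ⟨1, zero_le_one, le_rfl, (one_smul ℝ v).symm, by rw [one_mul, min_eq_left h]⟩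
  · have h' : r < ‖v‖ := not_le.mp h
    have hv : 0 < ‖v‖ := hr.trans_lt h'
    exact ⟨r / ‖v‖, by positivity, (div_le_one hv).2 h'.le, rfl,
      by rw [min_eq_right h'.le, div_mul_cancel₀ _ hv.ne']⟩

theorem radial_mul_norm (v : X) {l : ℝ} (hl : l ≤ 1) : radial v (l * ‖v‖) = l • v := by
  rcases eq_or_ne v 0 with rfl | hv
  · simp [radial]
  have hv' : 0 < ‖v‖ := norm_pos_iff.2 hv
  unfold radial
  split_ifs with h
  · have : l = 1 := le_antisymm hl (le_of_mul_le_mul_right (by linarith) hv')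
    rw [this, one_smul]
  · rw [mul_div_cancel_right₀ _ hv'.ne']

/-- Rescaling `a` to the norm of a shorter vector `b` gives a detour from `a` to `b` of length
at most `μ * ‖a - b‖`. -/
theorem RectBound.norm_rescale_sub_add_le {μ : ℝ} (h : RectBound X μ) {a b : X}
    (hab : ‖b‖ < ‖a‖) :
    ‖(‖b‖ / ‖a‖) • a - b‖ + (‖a‖ - ‖b‖) ≤ μ * ‖a - b‖ := by
  have ha : 0 < ‖a‖ := (norm_nonneg b).trans_lt hab
  obtain ⟨g, hg, hga⟩ := exists_dual_vector ℝ a ha.ne'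
  replace hga : g a = ‖a‖ := by simpa using hga
  have hgle : ∀ w : X, g w ≤ ‖w‖ := fun w =>
    (le_abs_self _).trans (by simpa [hg] using g.le_opNorm w)
  set τ : ℝ := g b / ‖a‖ with hτ
  have hτa : τ * ‖a‖ = g b := div_mul_cancel₀ _ ha.ne'
  set κ : ℝ := ‖b‖ / ‖a‖ with hκ
  have hκa : κ * ‖a‖ = ‖b‖ := div_mul_cancel₀ _ ha.ne'
  have hτκ : τ ≤ κ := by
    rw [hτ, hκ]
    gcongr
    exact hgle b
  have hκ1 : κ ≤ 1 := (div_le_one ha).2 hab.le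
  have horth : BJOrth ((1 - τ) • a) (τ • a - b) := by
    intro l
    have h1 := hgle ((1 - τ) • a + l • (τ • a - b))
    simp only [map_add, map_smul, map_sub, smul_eq_mul, hga, hτa, sub_self, mul_zero,
      add_zero] at h1
    rwa [norm_smul, Real.norm_of_nonneg (by linarith)]
  have h2 := h _ _ horth
  have e1 : (1 - τ) • a + (τ • a - b) = a - b := by module
  have e2 : κ • a - b = (κ - τ) • a + (τ • a - b) := by module
  rw [e1, norm_smul, Real.norm_of_nonneg (by linarith)] at h2
  have h3 : ‖κ • a - b‖ ≤ (κ - τ) * ‖a‖ + ‖τ • a - b‖ := by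
    rw [e2]
    refine (norm_add_le _ _).trans_eq ?_
    rw [norm_smul, Real.norm_of_nonneg (by linarith)]
  linarith

theorem RadialLipBound.norm_radial_sub_smul_le {μ : ℝ} (h : RadialLipBound X μ) (hμ : 0 ≤ μ)
    (a b : X) {l : ℝ} (hl0 : 0 ≤ l) (hl1 : l ≤ 1) :
    ‖radial a (l * ‖b‖) - l • b‖ ≤ μ * ‖a - b‖ := by
  have hr : 0 ≤ l * ‖b‖ := by positivity
  rcases hr.eq_or_lt with h0 | hpos
  · obtain ⟨t, ht0, -, hta, htn⟩ := exists_radial_eq_smul_s14 a hr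
    have h1 : ‖t • a‖ = 0 := by
      rw [norm_smul, Real.norm_of_nonneg ht0, htn, ← h0, min_eq_right (norm_nonneg a)]
    have h2 : ‖l • b‖ = 0 := by rw [norm_smul, Real.norm_of_nonneg hl0, ← h0]
    rw [hta, norm_eq_zero.1 h1, norm_eq_zero.1 h2, sub_zero, norm_zero]
    positivity
  · have := h a b _ hpos
    rwa [radial_mul_norm b hl1] at this

theorem norm_radial_sub_smul_add_le {μ : ℝ} (hμ : 0 ≤ μ) (hrect : RectBound X μ)
    (hlip : RadialLipBound X μ) (a b : X) {l : ℝ} (hl0 : 0 ≤ l) (hl1 : l ≤ 1) :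
    ‖radial a (l * ‖b‖) - l • b‖ + (‖a‖ - min ‖a‖ (l * ‖b‖)) ≤
      μ * ‖a - b‖ + (‖b‖ - l * ‖b‖) := by
  have hlb : l * ‖b‖ ≤ ‖b‖ := mul_le_of_le_one_left (norm_nonneg b) hl1
  rcases le_or_gt ‖a‖ ‖b‖ with hab | hab
  · have h1 := hlip.norm_radial_sub_smul_le hμ a b hl0 hl1
    rcases min_cases ‖a‖ (l * ‖b‖) with ⟨h, -⟩ | ⟨h, -⟩ <;> rw [h] <;> linarith
  · have h1 := hrect.norm_rescale_sub_add_le hab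
    have hlt : l * ‖b‖ < ‖a‖ := hlb.trans_lt hab
    have e : radial a (l * ‖b‖) - l • b = l • ((‖b‖ / ‖a‖) • a - b) := by
      rw [radial, if_neg (not_le.2 hlt), mul_div_assoc]
      module
    have h2 : l * ‖(‖b‖ / ‖a‖) • a - b‖ ≤ ‖(‖b‖ / ‖a‖) • a - b‖ :=
      mul_le_of_le_one_left (norm_nonneg _) hl1
    rw [e, norm_smul, Real.norm_of_nonneg hl0, min_eq_right hlt.le]
    linarith

/-- Points at equal distance from `s` and `s'` on the segments to a common endpoint `p` are no
farther apart than `s` and `s'`. -/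
theorem norm_segment_point_sub_le (s s' p : X) {t k : ℝ} (hk0 : 0 ≤ k) (hk1 : k ≤ 1)
    (ht : t * ‖p - s‖ = min ‖p - s‖ (k * ‖p - s'‖)) :
    ‖(s + t • (p - s)) - (s' + k • (p - s'))‖ ≤ ‖s - s'‖ := by
  have e : (s + t • (p - s)) - (s' + k • (p - s')) = (1 - k) • (s - s') + (t - k) • (p - s) := by
    module
  have hD : |‖p - s‖ - ‖p - s'‖| ≤ ‖s - s'‖ := by
    have := abs_norm_sub_norm_le (p - s) (p - s')
    rwa [sub_sub_sub_cancel_left, norm_sub_rev s' s] at this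
  obtain ⟨hD1, hD2⟩ := abs_le.1 hD
  have hD0 := norm_nonneg (p - s)
  have key : ‖(t - k) • (p - s)‖ ≤ k * ‖s - s'‖ := by
    rw [norm_smul, Real.norm_eq_abs, ← abs_of_nonneg hD0, ← abs_mul, sub_mul, ht]
    have m1 := mul_le_mul_of_nonneg_left hD1 hk0
    have m2 := mul_le_mul_of_nonneg_left hD2 hk0
    rcases min_cases ‖p - s‖ (k * ‖p - s'‖) with ⟨h, h'⟩ | ⟨h, h'⟩ <;> rw [h, abs_le]
    · have m3 := mul_le_mul_of_nonneg_left h' (sub_nonneg.2 hk1)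
      have m4 := mul_le_mul_of_nonneg_left h' hk0
      have m5 := mul_le_of_le_one_left hD0 hk1
      constructor <;> nlinarith
    · constructor <;> linarith
  rw [e]
  refine (norm_add_le _ _).trans ?_
  rw [norm_smul (1 - k), Real.norm_of_nonneg (sub_nonneg.2 hk1)]
  linarith

end RadialRetraction

/-- **Per-step consistency inequality for Interp.**
With `μ ≥ 1` a simultaneous rectangular and radial Lipschitz bound, `γ ≥ 0`, `f`
convex and nonnegative, `x'` on the segment `[s', adv']`, `Δ = f(adv) + ‖adv − adv'‖`,
`y = s' + ρ(adv − s'; ‖x' − s'‖)`, `z = s' + ρ(y − s'; max(‖y − s'‖ − γΔ, 0))`, and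
`x = s + ρ(adv − s; ‖z − s'‖)`, one has
`f(x) + ‖x − x'‖ + ‖adv − x‖ ≤ 2(f(s) + ‖s − s'‖) + (μ + 2γ)Δ + ‖adv' − x'‖`. -/
theorem interp_step_consistency
    {X : Type*} [NormedAddCommGroup X] [NormedSpace ℝ X]
    (μ : ℝ) (hμ1 : 1 ≤ μ) (hrect : RectBound X μ) (hlip : RadialLipBound X μ)
    (γ : ℝ) (hγ : 0 ≤ γ)
    (f : X → ℝ) (hconv : ConvexOn ℝ Set.univ f) (hnn : ∀ p : X, 0 ≤ f p)
    (s' s adv' adv x' : X)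
    (hx' : ∃ l : ℝ, l ∈ Set.Icc (0 : ℝ) 1 ∧ x' = l • adv' + (1 - l) • s')
    (Δ : ℝ) (hΔ : Δ = f adv + ‖adv - adv'‖)
    (y z x : X)
    (hy : y = s' + radial (adv - s') ‖x' - s'‖)
    (hz : z = s' + radial (y - s') (max (‖y - s'‖ - γ * Δ) 0))
    (hx : x = s + radial (adv - s) ‖z - s'‖) :
    f x + ‖x - x'‖ + ‖adv - x‖ ≤
      2 * (f s + ‖s - s'‖) + (μ + 2 * γ) * Δ + ‖adv' - x'‖ := by
  obtain ⟨l, ⟨hl0, hl1⟩, hl⟩ := hx'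
  have hΔ0 : 0 ≤ Δ := hΔ ▸ add_nonneg (hnn adv) (norm_nonneg _)
  have hx's : x' - s' = l • (adv' - s') := by rw [hl]; module
  have hr : ‖x' - s'‖ = l * ‖adv' - s'‖ := by
    rw [hx's, norm_smul, Real.norm_of_nonneg hl0]
  have hadvx' : ‖adv' - x'‖ = ‖adv' - s'‖ - l * ‖adv' - s'‖ := by
    have : adv' - x' = (1 - l) • (adv' - s') := by rw [hl]; module
    rw [this, norm_smul, Real.norm_of_nonneg (sub_nonneg.2 hl1)]
    ring
  have hyx' : ‖y - x'‖ + (‖adv - s'‖ - min ‖adv - s'‖ ‖x' - s'‖) ≤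
      μ * ‖adv - adv'‖ + ‖adv' - x'‖ := by
    have h := norm_radial_sub_smul_add_le (by linarith) hrect hlip (adv - s') (adv' - s') hl0 hl1
    rwa [← hr, ← hx's, sub_sub_sub_cancel_right, hr, ← hadvx', ← hr,
      show radial (adv - s') ‖x' - s'‖ - (x' - s') = y - x' by rw [hy]; abel] at h
  obtain ⟨t₁, ht₁0, ht₁1, ht₁, ht₁n⟩ :=
    exists_radial_eq_smul_s14 (adv - s') (norm_nonneg (x' - s'))
  have hys : y - s' = t₁ • (adv - s') := by rw [hy, ht₁]; abel
  have hysn : ‖y - s'‖ = t₁ * ‖adv - s'‖ := by rw [hys, norm_smul, Real.norm_of_nonneg ht₁0]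
  obtain ⟨t₂, ht₂0, ht₂1, ht₂, ht₂n⟩ :=
    exists_radial_eq_smul_s14 (y - s') (le_max_right (‖y - s'‖ - γ * Δ) 0)
  have hγΔ : 0 ≤ γ * Δ := mul_nonneg hγ hΔ0
  rw [min_eq_right (max_le (by linarith) (norm_nonneg _))] at ht₂n
  have hzs : z - s' = (t₂ * t₁) • (adv - s') := by rw [hz, ht₂, hys, smul_smul]; abel
  have hk0 : 0 ≤ t₂ * t₁ := mul_nonneg ht₂0 ht₁0
  have hk1 : t₂ * t₁ ≤ 1 := mul_le_one₀ ht₂1 ht₁0 ht₁1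
  have hzsn : ‖z - s'‖ = t₂ * t₁ * ‖adv - s'‖ := by
    rw [hzs, norm_smul, Real.norm_of_nonneg hk0]
  have hq : ‖y - s'‖ - γ * Δ ≤ t₂ * ‖y - s'‖ := ht₂n ▸ le_max_left _ _
  have hzy : ‖z - y‖ ≤ γ * Δ := by
    have : z - y = -((1 - t₂) • (y - s')) := by
      rw [← sub_sub_sub_cancel_right z y s', hz, ht₂]
      module
    rw [this, norm_neg, norm_smul, Real.norm_of_nonneg (sub_nonneg.2 ht₂1)]
    linarith
  obtain ⟨t, ht0, ht1, ht, htn⟩ := exists_radial_eq_smul_s14 (adv - s) (norm_nonneg (z - s'))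
  rw [ht] at hx
  rw [hzsn] at htn
  have hxz : ‖x - z‖ ≤ ‖s - s'‖ := by
    have h := norm_segment_point_sub_le s s' adv hk0 hk1 htn
    rwa [← hzs, ← hx, add_sub_cancel] at h
  have hadvx : ‖adv - x‖ ≤ ‖s - s'‖ + (‖adv - s'‖ - min ‖adv - s'‖ ‖x' - s'‖) + γ * Δ := by
    have h1 : adv - x = (1 - t) • (adv - s) := by rw [hx]; module
    have h2 : ‖adv - s‖ ≤ ‖adv - s'‖ + ‖s - s'‖ := by
      rw [norm_sub_rev s s']
      exact norm_sub_le_norm_sub_add_norm_sub adv s' s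
    have h3 := min_le_left ‖adv - s'‖ ‖x' - s'‖
    have h4 := norm_nonneg (s - s')
    rw [h1, norm_smul, Real.norm_of_nonneg (sub_nonneg.2 ht1), sub_mul, one_mul, htn]
    rw [hysn, ht₁n] at hq
    rw [mul_assoc, ht₁n]
    rcases min_cases ‖adv - s‖ (t₂ * min ‖adv - s'‖ ‖x' - s'‖) with ⟨h, -⟩ | ⟨h, -⟩ <;>
      rw [h] <;> linarith
  have hfx : f x ≤ f s + f adv := by
    have h := hconv.2 (Set.mem_univ s) (Set.mem_univ adv) (sub_nonneg.2 ht1) ht0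
      (sub_add_cancel 1 t)
    rw [show (1 - t) • s + t • adv = x by rw [hx]; module, smul_eq_mul, smul_eq_mul] at h
    have h1 := mul_le_of_le_one_left (hnn s) (sub_le_self 1 ht0)
    have h2 := mul_le_of_le_one_left (hnn adv) ht1
    linarith
  have hxx' : ‖x - x'‖ ≤ ‖x - z‖ + ‖z - y‖ + ‖y - x'‖ := by
    have h1 := norm_sub_le_norm_sub_add_norm_sub x z x'
    have h2 := norm_sub_le_norm_sub_add_norm_sub z y x'
    linarith
  have hμF : f adv ≤ μ * f adv := le_mul_of_one_le_left (hnn adv) hμ1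
  have hμΔ : μ * Δ = μ * f adv + μ * ‖adv - adv'‖ := by rw [hΔ, mul_add]
  linarith [hnn s]
end
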